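/- Let A ∈ ℕ^ℕ and let P be a Π^{0,A'}_1 subset of ℕ^ℕ. Then there exist a Π^{0,A}_1 set Q ⊆ ℕ^ℕ and a homeomorphism H: P → Q such that X ⊕ A' ≡_T H(X) ⊕ A' ≡_T (H(X) ⊕ A)' uniformly for all X ∈ P. -/

import Mathlib

namespace Harrington

open scoped Classical

/-- Codes for oracle Turing machines (partial recursive functionals),
    extending `Nat.Partrec.Code` with an `oracle` constructor. -/
inductive OCode : Type
  | zero : OCode
  | succ : OCode
  | left : OCode
  | right : OCode
  | oracle : OCode
  | pair : OCode → OCode → OCode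
  | comp : OCode → OCode → OCode
  | prec : OCode → OCode → OCode
  | rfind' : OCode → OCode

/-- Evaluation of an oracle code relative to a (total) oracle `A`. -/
def evalo (A : ℕ → ℕ) : OCode → ℕ →. ℕ
  | OCode.zero => pure 0
  | OCode.succ => fun n => Part.some (n + 1)
  | OCode.left => fun n => Part.some (Nat.unpair n).1
  | OCode.right => fun n => Part.some (Nat.unpair n).2
  | OCode.oracle => fun n => Part.some (A n)
  | OCode.pair cf cg => fun n => Nat.pair <$> evalo A cf n <*> evalo A cg n
  | OCode.comp cf cg => fun n => evalo A cg n >>= evalo A cf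
  | OCode.prec cf cg =>
    Nat.unpaired fun a n =>
      n.rec (evalo A cf a) fun y IH => do
        let i ← IH
        evalo A cg (Nat.pair a (Nat.pair y i))
  | OCode.rfind' cf =>
    Nat.unpaired fun a m =>
      (Nat.rfind fun n => (fun x => x = 0) <$> evalo A cf (Nat.pair a (n + m))).map (· + m)

/-- The standard enumeration of oracle codes: `OCode.ofNat e` is the `e`-th oracle machine. -/
def OCode.ofNat : ℕ → OCode
  | 0 => OCode.zero
  | 1 => OCode.succ
  | 2 => OCode.left
  | 3 => OCode.right
  | 4 => OCode.oracle
  | n + 5 =>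
    have hm : n.div2.div2 < n + 5 := by
      have h1 : n.div2.div2 ≤ n := by
        simp only [Nat.div2_val]
        exact le_trans (Nat.div_le_self _ _) (Nat.div_le_self _ _)
      omega
    have _m1 : n.div2.div2.unpair.1 < n + 5 := lt_of_le_of_lt (Nat.unpair_left_le _) hm
    have _m2 : n.div2.div2.unpair.2 < n + 5 := lt_of_le_of_lt (Nat.unpair_right_le _) hm
    match n.bodd, n.div2.bodd with
    | false, false => OCode.pair (OCode.ofNat n.div2.div2.unpair.1) (OCode.ofNat n.div2.div2.unpair.2)
    | false, true  => OCode.comp (OCode.ofNat n.div2.div2.unpair.1) (OCode.ofNat n.div2.div2.unpair.2)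
    | true,  false => OCode.prec (OCode.ofNat n.div2.div2.unpair.1) (OCode.ofNat n.div2.div2.unpair.2)
    | true,  true  => OCode.rfind' (OCode.ofNat n.div2.div2)

/-- The Turing jump `A'` of an oracle `A`:  `A'(e) = 1` if the `e`-th machine with
    oracle `A` halts on input `e`, and `A'(e) = 0` otherwise. -/
noncomputable def jump (A : ℕ → ℕ) : ℕ → ℕ :=
  fun e => if (evalo A (OCode.ofNat e) e).Dom then 1 else 0

/-- Iterated Turing jump `A^{(n)}`. -/
noncomputable def jumpIter (A : ℕ → ℕ) : ℕ → (ℕ → ℕ)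
  | 0 => A
  | n + 1 => jump (jumpIter A n)

/-- The constant zero function (the trivial oracle `0`). -/
def zeroF : ℕ → ℕ := fun _ => 0

/-- The `ω`-jump: `X^{(ω)} = {(i,n) : i ∈ X^{(n)}}`, coded via `Nat.pair` and identified
    with its characteristic function. -/
noncomputable def omegaJump (A : ℕ → ℕ) : ℕ → ℕ :=
  fun m => if jumpIter A m.unpair.2 m.unpair.1 ≠ 0 then 1 else 0

/-- The recursive join `A ⊕ B`. -/
def oplus (A B : ℕ → ℕ) : ℕ → ℕ :=
  fun n => if n % 2 = 0 then A (n / 2) else B (n / 2)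

/-- Code `c` computes the total function `f` from oracle `A`. -/
def computesFn (A : ℕ → ℕ) (c : OCode) (f : ℕ → ℕ) : Prop :=
  ∀ n, evalo A c n = Part.some (f n)

/-- Turing reducibility `X ≤_T A` for points of Baire space. -/
def TRedIn (X A : ℕ → ℕ) : Prop := ∃ c : OCode, computesFn A c X

/-- `X` is arithmetical relative to `Y`: `X ≤_T Y^{(n)}` for some `n`. -/
def ArithIn (X Y : ℕ → ℕ) : Prop := ∃ n : ℕ, TRedIn X (jumpIter Y n)

/-- `X` and `Y` are arithmetically equivalent. -/
def ArithEquiv (X Y : ℕ → ℕ) : Prop := ArithIn X Y ∧ ArithIn Y X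

/-! ### Strings and trees -/

/-- Strings: finite sequences of natural numbers. -/
abbrev Str := List ℕ

/-- The initial segment `X↾n` of a point `X` of Baire space. -/
def initSeg (X : ℕ → ℕ) (n : ℕ) : Str := (List.range n).map X

/-- A tree is a set of strings closed under initial segments. -/
def IsTree (T : Set Str) : Prop := ∀ σ τ : Str, σ <+: τ → τ ∈ T → σ ∈ T

/-- `[T]`, the set of paths through `T`. -/
def paths (T : Set Str) : Set (ℕ → ℕ) := {X | ∀ n, initSeg X n ∈ T}

/-- The characteristic function of a set of strings. -/
noncomputable def chi (T : Set Str) : Str → ℕ := fun σ => if σ ∈ T then 1 else 0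

/-- A set of strings is `A`-recursive: its characteristic function is computable from `A`. -/
def SetRecIn (A : ℕ → ℕ) (T : Set Str) : Prop :=
  ∃ c : OCode, ∀ σ : Str, evalo A c (Encodable.encode σ) = Part.some (chi T σ)

/-- `P ⊆ ℕ^ℕ` is `Π^{0,A}_1` : `P = [T]` for some `A`-recursive tree `T`. -/
def IsPi01In (A : ℕ → ℕ) (P : Set (ℕ → ℕ)) : Prop :=
  ∃ T : Set Str, IsTree T ∧ SetRecIn A T ∧ P = paths T

/-- `P ⊆ ℕ^ℕ` is `Π⁰₁` : `P = [T]` for some recursive tree `T`. -/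
def IsPi01 (P : Set (ℕ → ℕ)) : Prop := IsPi01In zeroF P

/-! ### Treemaps -/

/-- `F` is a treemap on the tree `T`: `F(σ⌢⟨i⟩) ⊇ F(σ)⌢⟨i⟩` whenever `σ⌢⟨i⟩ ∈ T`. -/
def IsTreemapOn (T : Set Str) (F : Str → Str) : Prop :=
  ∀ (σ : Str) (i : ℕ), σ ++ [i] ∈ T → (F σ) ++ [i] <+: F (σ ++ [i])

/-- The image tree `F(T) = {τ : ∃ σ ∈ T, τ ⊆ F(σ)}`. -/
def treeImage (F : Str → Str) (T : Set Str) : Set Str :=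
  {τ | ∃ σ ∈ T, τ <+: F σ}

/-- The map on paths induced by a treemap: `X ↦ ⋃ₙ F(X↾n)`. -/
def pathMap (F : Str → Str) (X : ℕ → ℕ) : ℕ → ℕ :=
  fun i => (F (initSeg X (i + 1))).getD i 0

/-- The string function `F` is `A`-recursive on `T` (restriction of a partial
    `A`-recursive function). -/
def FnRecInOn (A : ℕ → ℕ) (F : Str → Str) (T : Set Str) : Prop :=
  ∃ c : OCode, ∀ σ ∈ T, evalo A c (Encodable.encode σ) = Part.some (Encodable.encode (F σ))

/-- `F` maps `P` homeomorphically onto `Q` (subspace topologies from Baire space). -/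
def HomeoOn (F : (ℕ → ℕ) → (ℕ → ℕ)) (P Q : Set (ℕ → ℕ)) : Prop :=
  Set.BijOn F P Q ∧ ContinuousOn F P ∧
    ∃ G : (ℕ → ℕ) → (ℕ → ℕ), Set.InvOn G F P Q ∧ ContinuousOn G Q

/-- `f X ≡_T g X` uniformly for all `X ∈ P`: the Turing reductions are given by
    fixed indices independent of `X`. -/
def UnifEquivOn (P : Set (ℕ → ℕ)) (f g : (ℕ → ℕ) → (ℕ → ℕ)) : Prop :=
  ∃ c d : OCode, ∀ X ∈ P, computesFn (g X) c (f X) ∧ computesFn (f X) d (g X)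

/-! ### Standard enumerations -/

/-- `W_e^A`: the `e`-th `A`-recursively enumerable set of strings. -/
def WA (A : ℕ → ℕ) (e : ℕ) : Set Str :=
  {σ | (evalo A (OCode.ofNat e) (Encodable.encode σ)).Dom}

/-- `T_e^A = {σ : ∀ n ≤ |σ|, σ↾n ∉ W_e^A}`: the standard enumeration of `Π^{0,A}_1` trees. -/
def TA (A : ℕ → ℕ) (e : ℕ) : Set Str :=
  {σ | ∀ n ≤ σ.length, σ.take n ∉ WA A e}

/-- `P_e^A = [T_e^A]`: the standard enumeration of `Π^{0,A}_1` subsets of Baire space. -/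
def PA (A : ℕ → ℕ) (e : ℕ) : Set (ℕ → ℕ) := paths (TA A e)

/-! ### The arithmetical hierarchy on Baire space -/

/-- Prepend a number to a point of Baire space. -/
def consF (k : ℕ) (X : ℕ → ℕ) : ℕ → ℕ := fun i => Nat.casesOn i k fun j => X j

/-- `Σ⁰ₙ` subsets of Baire space.  `Σ⁰₀` sets are the recursive clopen sets
    (depending computably on a fixed finite initial segment), and
    `Σ⁰ₙ₊₁` sets are obtained from `Π⁰ₙ` sets by existential number quantification. -/
def SigmaN : ℕ → Set (ℕ → ℕ) → Prop
  | 0, P => ∃ (k : ℕ) (f : Str → Bool), Computable f ∧ P = {X | f (initSeg X k) = true}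
  | n + 1, P => ∃ Q : Set (ℕ → ℕ), SigmaN n Qᶜ ∧ P = {X | ∃ k : ℕ, consF k X ∈ Q}

/-- `Π⁰ₙ` subsets of Baire space: complements of `Σ⁰ₙ` sets. -/
def PiN (n : ℕ) (P : Set (ℕ → ℕ)) : Prop := SigmaN n Pᶜ

/-- Arithmetical subsets of Baire space: `Π⁰ₙ` for some `n`. -/
def IsArith (P : Set (ℕ → ℕ)) : Prop := ∃ n : ℕ, PiN n P

section

open Encodable Nat.Partrec Filter

/-- `f i` is computable from the oracle `O i`, by a code that does not depend on `i`. -/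
def UnifComp {ι α β : Type*} [Primcodable α] [Primcodable β] (O : ι → ℕ → ℕ) (f : ι → α → β) :
    Prop :=
  ∃ c : OCode, ∀ i a, evalo (O i) c (encode a) = Part.some (encode (f i a))

/-- Ordinary codes, seen as oracle codes. -/
def OCode.ofCode : Nat.Partrec.Code → OCode
  | .zero => .zero
  | .succ => .succ
  | .left => .left
  | .right => .right
  | .pair a b => .pair (ofCode a) (ofCode b)
  | .comp a b => .comp (ofCode a) (ofCode b)
  | .prec a b => .prec (ofCode a) (ofCode b)
  | .rfind' a => .rfind' (ofCode a)

theorem evalo_ofCode (O : ℕ → ℕ) (c : Nat.Partrec.Code) : evalo O (OCode.ofCode c) = c.eval := by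
  induction c <;> simp_all [OCode.ofCode, evalo, Nat.Partrec.Code.eval] <;> rfl

theorem exists_evalo_eq (f : ℕ →. ℕ) (hf : Nat.Partrec f) : ∃ c, ∀ O, evalo O c = f := by
  obtain ⟨c, hc⟩ := Nat.Partrec.Code.exists_code.1 hf
  exact ⟨.ofCode c, fun O => by rw [evalo_ofCode, hc]⟩

theorem evalo_comp {O : ℕ → ℕ} {c d : OCode} {n m : ℕ} (h : evalo O d n = Part.some m) :
    evalo O (.comp c d) n = evalo O c m := by
  change evalo O d n >>= evalo O c = _
  rw [h]
  exact Part.bind_some m _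

/-- Substitution of `d` for the oracle. -/
def OCode.subst (d : OCode) : OCode → OCode
  | .zero => .zero
  | .succ => .succ
  | .left => .left
  | .right => .right
  | .oracle => d
  | .pair a b => .pair (subst d a) (subst d b)
  | .comp a b => .comp (subst d a) (subst d b)
  | .prec a b => .prec (subst d a) (subst d b)
  | .rfind' a => .rfind' (subst d a)

theorem evalo_subst {O O' : ℕ → ℕ} {d : OCode} (h : computesFn O' d O) (c : OCode) :
    evalo O' (d.subst c) = evalo O c := by
  induction c with
  | oracle => funext n; exact h n
  | zero | succ | left | right => rfl
  | pair a b iha ihb | comp a b iha ihb | prec a b iha ihb =>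
    simp only [OCode.subst, evalo, iha, ihb]; rfl
  | rfind' a ih => simp only [OCode.subst, evalo, ih]; rfl

namespace UnifComp

variable {ι κ α β γ σ : Type*} [Primcodable α] [Primcodable β] [Primcodable γ] [Primcodable σ]
  {O O' : ι → ℕ → ℕ}

theorem reindex {f : ι → α → β} (h : UnifComp O f) (r : κ → ι) :
    UnifComp (fun k => O (r k)) (fun k => f (r k)) :=
  h.imp fun _ hc k => hc (r k)

theorem of_oracle {f : ι → α → β} (h : UnifComp O f) (hO : UnifComp O' O) : UnifComp O' f := by
  obtain ⟨c, hc⟩ := h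
  obtain ⟨d, hd⟩ := hO
  exact ⟨d.subst c, fun i a => by rw [evalo_subst (O := O i) (hd i), hc]⟩

theorem of_computable {f : α → β} (hf : Computable f) : UnifComp O (fun _ => f) := by
  obtain ⟨c, hc⟩ := exists_evalo_eq _ hf
  exact ⟨c, fun i a => by simp [hc]⟩

theorem of_primrec {f : α → β} (hf : Primrec f) : UnifComp O (fun _ => f) :=
  of_computable hf.to_comp

theorem oracle : UnifComp O O := ⟨.oracle, fun _ _ => rfl⟩

theorem id : UnifComp O (fun _ (a : α) => a) := of_computable Computable.id

theorem const (b : β) : UnifComp O (fun _ (_ : α) => b) := of_computable (Computable.const b)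

theorem comp {g : ι → β → γ} {f : ι → α → β} (hg : UnifComp O g) (hf : UnifComp O f) :
    UnifComp O (fun i a => g i (f i a)) := by
  obtain ⟨c, hc⟩ := hg
  obtain ⟨d, hd⟩ := hf
  exact ⟨.comp c d, fun i a => by rw [evalo_comp (hd i a), hc]⟩

theorem pair {g : ι → α → γ} {f : ι → α → β} (hf : UnifComp O f) (hg : UnifComp O g) :
    UnifComp O (fun i a => (f i a, g i a)) := by
  obtain ⟨c, hc⟩ := hf
  obtain ⟨d, hd⟩ := hg
  exact ⟨.pair c d, fun i a => by simp [evalo, hc, hd, Seq.seq]⟩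

theorem fst {f : ι → α → β × γ} (hf : UnifComp O f) : UnifComp O (fun i a => (f i a).1) :=
  (of_computable Computable.fst).comp hf

theorem snd {f : ι → α → β × γ} (hf : UnifComp O f) : UnifComp O (fun i a => (f i a).2) :=
  (of_computable Computable.snd).comp hf

theorem comp₂ {h : β → γ → σ} {f : ι → α → β} {g : ι → α → γ} (hh : Primrec₂ h)
    (hf : UnifComp O f) (hg : UnifComp O g) : UnifComp O (fun i a => h (f i a) (g i a)) :=
  (of_computable (f := fun p : β × γ => h p.1 p.2) hh.to_comp).comp (hf.pair hg)

theorem comp₁ {h : β → σ} {f : ι → α → β} (hh : Primrec h)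
    (hf : UnifComp O f) : UnifComp O (fun i a => h (f i a)) :=
  (of_primrec hh).comp hf

theorem const_oracle {A : ℕ → ℕ} {f : α → β} (h : UnifComp (fun _ : Unit => A) fun _ => f)
    (hO : UnifComp O fun _ => A) : UnifComp O fun _ => f :=
  (h.reindex fun _ : ι => ()).of_oracle hO

theorem nat_rec {f : ι → α → β} {g : ι → α × ℕ × β → β} {n : ι → α → ℕ}
    (hf : UnifComp O f) (hg : UnifComp O g) (hn : UnifComp O n) :
    UnifComp O (fun i a => Nat.rec (motive := fun _ => β) (f i a)
      (fun y IH => g i (a, y, IH)) (n i a)) := by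
  obtain ⟨c, hc⟩ := hf
  obtain ⟨d, hd⟩ := hg
  obtain ⟨e, he⟩ := (id (O := O) (α := α)).pair hn
  refine ⟨.comp (.prec c d) e, fun i a => ?_⟩
  have key : ∀ m : ℕ, evalo (O i) (.prec c d) (Nat.pair (encode a) m) = Part.some
      (encode (Nat.rec (motive := fun _ => β) (f i a) (fun y IH => g i (a, y, IH)) m)) := by
    intro m
    induction m with
    | zero => simpa [evalo] using hc i a
    | succ m ih =>
      simp only [evalo, Nat.unpaired, Nat.unpair_pair] at ih ⊢
      rw [ih]
      simpa using hd i (a, m, _)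
  have := he i a
  simp only [encode_prod_val, encode_nat] at this
  rw [evalo_comp this]
  simpa using key (n i a)

theorem ite {p : ι → α → Bool} {f g : ι → α → β} (hp : UnifComp O p) (hf : UnifComp O f)
    (hg : UnifComp O g) : UnifComp O (fun i a => bif p i a then f i a else g i a) :=
  (of_primrec (f := fun q : Bool × β × β => bif q.1 then q.2.1 else q.2.2)
    (Primrec.cond .fst (.comp .fst .snd) (.comp .snd .snd))).comp (hp.pair (hf.pair hg))

theorem not {p : ι → α → Bool} (hp : UnifComp O p) : UnifComp O (fun i a => !p i a) :=
  (of_primrec Primrec.not).comp hp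

theorem and {p q : ι → α → Bool} (hp : UnifComp O p) (hq : UnifComp O q) :
    UnifComp O (fun i a => p i a && q i a) := comp₂ Primrec.and hp hq

theorem or {p q : ι → α → Bool} (hp : UnifComp O p) (hq : UnifComp O q) :
    UnifComp O (fun i a => p i a || q i a) := comp₂ Primrec.or hp hq

theorem of_primrecPred {p : α → Prop} [DecidablePred p] (hp : PrimrecPred p) :
    UnifComp O (fun _ a => decide (p a)) := by
  obtain ⟨_, h⟩ := hp
  convert of_primrec h

theorem rel {p : β → γ → Prop} [DecidableRel p] {f : ι → α → β} {g : ι → α → γ} (hp : PrimrecRel p)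
    (hf : UnifComp O f) (hg : UnifComp O g) :
    UnifComp O (fun i a => decide (p (f i a) (g i a))) :=
  (of_primrecPred (p := fun q : β × γ => p q.1 q.2) hp).comp (hf.pair hg)

theorem forall_lt {p : ι → α × ℕ → Bool} {n : ι → α → ℕ} (hp : UnifComp O p)
    (hn : UnifComp O n) : UnifComp O (fun i a => decide (∀ k < n i a, p i (a, k) = true)) := by
  have h := nat_rec (f := fun _ (_ : α) => true) (g := fun i q => q.2.2 && p i (q.1, q.2.1))
    (const true)
    (id.snd.snd.and (hp.comp (id.fst.pair id.snd.fst))) hn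
  convert h using 3 with i a
  induction n i a with
  | zero => simp
  | succ m ih =>
    simp only [← ih, Nat.lt_succ_iff_lt_or_eq]
    rw [Bool.eq_iff_iff]
    simp only [decide_eq_true_eq, Bool.and_eq_true]
    grind

theorem find {p : ι → α × ℕ → Bool} (hp : UnifComp O p)
    (h : ∀ i a, ∃ n, p i (a, n) = true) : UnifComp O (fun i a => Nat.find (h i a)) := by
  obtain ⟨c, hc⟩ := hp.not
  obtain ⟨e, he⟩ := (id (O := O) (α := α)).pair (const (0 : ℕ))
  refine ⟨.comp (.rfind' c) e, fun i a => ?_⟩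
  have := he i a
  simp only [encode_prod_val, encode_nat] at this
  rw [evalo_comp this]
  have hc' : ∀ n, evalo (O i) c (Nat.pair (encode a) n) = Part.some (encode (!p i (a, n))) :=
    fun n => hc i (a, n)
  simp only [evalo, Nat.unpaired, Nat.unpair_pair, Nat.add_zero,
    hc', encode_nat]
  rw [Part.eq_some_iff]
  simp only [Part.mem_map_iff]
  refine ⟨Nat.find (h i a), Nat.mem_rfind.2 ⟨?_, ?_⟩, rfl⟩
  · simp [Nat.find_spec (h i a)]
  · intro m hm
    have := Nat.find_min (h i a) hm
    simp at this
    simp [this]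

theorem map_range {f : ι → α × ℕ → β} {n : ι → α → ℕ} (hf : UnifComp O f) (hn : UnifComp O n) :
    UnifComp O (fun i a => (List.range (n i a)).map fun k => f i (a, k)) := by
  have h := nat_rec (f := fun _ (_ : α) => ([] : List β))
    (g := fun i q => q.2.2 ++ [f i (q.1, q.2.1)]) (const [])
    (comp₂ (h := fun (l : List β) b => l ++ [b]) Primrec.list_concat id.snd.snd
      (hf.comp (id.fst.pair id.snd.fst))) hn
  convert h using 3 with i a
  induction n i a with
  | zero => simp
  | succ m ih => simp [← ih, List.range_succ]

theorem initSeg {f : ι → ℕ → ℕ} {n : ι → α → ℕ} (hf : UnifComp O f) (hn : UnifComp O n) :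
    UnifComp O (fun i a => initSeg (f i) (n i a)) :=
  map_range (hf.comp id.snd) hn

theorem oplus {f g : ι → ℕ → ℕ} (hf : UnifComp O f) (hg : UnifComp O g) :
    UnifComp O (fun i => oplus (f i) (g i)) := by
  have h2 : UnifComp O (fun _ (n : ℕ) => n / 2) :=
    of_primrec (Primrec.nat_div.comp .id (.const 2))
  have h := ite (of_primrecPred (O := O) (p := fun n : ℕ => n % 2 = 0)
    (Primrec.eq.comp (Primrec.nat_mod.comp .id (.const 2)) (.const 0))) (hf.comp h2) (hg.comp h2)
  convert h using 3 with i n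
  simp only [Harrington.oplus]
  split_ifs <;> simp_all

theorem oplus_left {f g : ι → ℕ → ℕ} : UnifComp (fun i => Harrington.oplus (f i) (g i)) f := by
  have h := oracle.comp (of_primrec (O := fun i => Harrington.oplus (f i) (g i))
    (f := fun n : ℕ => 2 * n) (Primrec.nat_mul.comp (.const 2) .id))
  convert h using 3
  simp [Harrington.oplus]

theorem oplus_right {f g : ι → ℕ → ℕ} : UnifComp (fun i => Harrington.oplus (f i) (g i)) g := by
  have h := oracle.comp (of_primrec (O := fun i => Harrington.oplus (f i) (g i))
    (f := fun n : ℕ => 2 * n + 1) (Primrec.succ.comp (Primrec.nat_mul.comp (.const 2) .id)))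
  convert h using 3
  simp [Harrington.oplus, Nat.add_mod]
  congr 1; omega

end UnifComp

/-! ### Approximation of partial functions along a filter -/

/-- Every value of `f` is eventually a value of `F j`. -/
def EvLe {J : Type*} (l : Filter J) (f : ℕ →. ℕ) (F : J → ℕ →. ℕ) : Prop :=
  ∀ n x, x ∈ f n → ∀ᶠ j in l, x ∈ F j n

namespace EvLe

variable {J : Type*} {l : Filter J} {f g : ℕ →. ℕ} {F G : J → ℕ →. ℕ}

theorem pair (hf : EvLe l f F) (hg : EvLe l g G) :
    EvLe l (fun n => Nat.pair <$> f n <*> g n) (fun j n => Nat.pair <$> F j n <*> G j n) := by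
  intro n x hx
  simp only [Seq.seq, Part.map_eq_map, Part.bind_map, Part.mem_bind_iff, Part.mem_map_iff] at hx ⊢
  obtain ⟨a, ha, b, hb, rfl⟩ := hx
  filter_upwards [hf n a ha, hg n b hb] with j h1 h2
  exact ⟨a, h1, b, h2, rfl⟩

theorem comp (hf : EvLe l f F) (hg : EvLe l g G) :
    EvLe l (fun n => g n >>= f) (fun j n => G j n >>= F j) := by
  intro n x hx
  obtain ⟨a, ha, hb⟩ := Part.mem_bind_iff.1 hx
  filter_upwards [hg n a ha, hf a x hb] with j h1 h2
  exact Part.mem_bind_iff.2 ⟨a, h1, h2⟩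

theorem prec (hf : EvLe l f F) (hg : EvLe l g G) :
    EvLe l (Nat.unpaired fun a n => n.rec (f a) fun y IH => do
        let i ← IH
        g (Nat.pair a (Nat.pair y i)))
      (fun j => Nat.unpaired fun a n => n.rec (F j a) fun y IH => do
        let i ← IH
        G j (Nat.pair a (Nat.pair y i))) := by
  intro n
  simp only [Nat.unpaired]
  generalize n.unpair.1 = a
  induction n.unpair.2 with
  | zero => exact hf a
  | succ m ih =>
    intro x hx
    obtain ⟨i, hi, hx⟩ := Part.mem_bind_iff.1 hx
    filter_upwards [ih i hi, hg _ x hx] with j h1 h2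
    exact Part.mem_bind_iff.2 ⟨i, h1, h2⟩

theorem rfind' (hf : EvLe l f F) :
    EvLe l (Nat.unpaired fun a m =>
        (Nat.rfind fun n => (fun x => x = 0) <$> f (Nat.pair a (n + m))).map (· + m))
      (fun j => Nat.unpaired fun a m =>
        (Nat.rfind fun n => (fun x => x = 0) <$> F j (Nat.pair a (n + m))).map (· + m)) := by
  intro n x hx
  simp only [Nat.unpaired, Part.mem_map_iff] at hx ⊢
  obtain ⟨y, hy, rfl⟩ := hx
  obtain ⟨h1, h2⟩ := Nat.mem_rfind.1 hy
  obtain ⟨z, hz, hz0⟩ := (Part.mem_map_iff _).1 h1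
  have h2' : ∀ m ∈ Finset.range y, ∃ w, w ∈ f (Nat.pair n.unpair.1 (m + n.unpair.2)) ∧
      decide (w = 0) = false := fun m hm => (Part.mem_map_iff _).1 (h2 (Finset.mem_range.1 hm))
  choose! w hw hw0 using h2'
  have h3 := (Filter.eventually_all_finset (l := l) (Finset.range y)
    (p := fun m j => w m ∈ F j (Nat.pair n.unpair.1 (m + n.unpair.2)))).2
    fun m hm => hf _ _ (hw m hm)
  filter_upwards [h3, hf _ z hz] with j h3 h4
  refine ⟨y, Nat.mem_rfind.2 ⟨(Part.mem_map_iff _).2 ⟨z, h4, hz0⟩, fun {m} hm => ?_⟩, rfl⟩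
  have hm := Finset.mem_range.2 hm
  exact (Part.mem_map_iff _).2 ⟨w m, h3 m hm, hw0 m hm⟩

end EvLe

/-! ### Translation of oracle codes with a finite oracle to ordinary codes -/

theorem exists_lookupCode : ∃ c : Code, ∀ (τ : Str) (n : ℕ),
    c.eval (Nat.pair (encode τ) n) = Part.ofOption τ[n]? := by
  have h : Partrec fun p : Str × ℕ => (Part.ofOption p.1[p.2]? : Part ℕ) :=
    Computable.ofOption (Primrec.list_getElem?.comp .fst .snd).to_comp
  obtain ⟨c, hc⟩ := Code.exists_code.1 h
  refine ⟨c, fun τ n => ?_⟩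
  have hd : decode (Nat.pair (encode τ) n) = some (τ, n) := by simp
  rw [hc]
  simp only [hd, Part.coe_some, Part.bind_some]
  exact Part.map_id' (fun _ => rfl) _

/-- A code for looking up the entries of a coded string. -/
noncomputable def lookupCode : Code := exists_lookupCode.choose

/-- The ordinary code obtained by answering oracle questions with the entries of `τ`. -/
noncomputable def OCode.toCode (τ : Str) : OCode → Code
  | .zero => .zero
  | .succ => .succ
  | .left => .left
  | .right => .right
  | .oracle => lookupCode.curry (encode τ)
  | .pair a b => .pair (toCode τ a) (toCode τ b)
  | .comp a b => .comp (toCode τ a) (toCode τ b)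
  | .prec a b => .prec (toCode τ a) (toCode τ b)
  | .rfind' a => .rfind' (toCode τ a)

theorem OCode.eval_toCode_oracle (τ : Str) (n : ℕ) :
    (OCode.oracle.toCode τ).eval n = Part.ofOption τ[n]? := by
  rw [OCode.toCode, Code.eval_curry, lookupCode, exists_lookupCode.choose_spec]

theorem evalo_of_mem_toCode {τ : Str} {O : ℕ → ℕ} (h : ∀ n v, τ[n]? = some v → O n = v)
    (c : OCode) : EvLe (⊤ : Filter Unit) (c.toCode τ).eval (fun _ => evalo O c) := by
  induction c with
  | zero | succ | left | right => exact fun n x hx => Eventually.of_forall fun _ => hx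
  | oracle =>
    intro n x hx
    rw [OCode.eval_toCode_oracle] at hx
    exact Eventually.of_forall fun _ =>
      Part.mem_some_iff.2 (h n x (Part.mem_ofOption.1 hx)).symm
  | pair a b iha ihb => exact iha.pair ihb
  | comp a b iha ihb => exact iha.comp ihb
  | prec a b iha ihb => exact iha.prec ihb
  | rfind' a iha => exact iha.rfind'

@[simp] theorem length_initSeg (X : ℕ → ℕ) (n : ℕ) : (initSeg X n).length = n := by simp [initSeg]

theorem getElem?_initSeg {X : ℕ → ℕ} {n i : ℕ} (h : i < n) : (initSeg X n)[i]? = some (X i) := by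
  simp [initSeg, h]

theorem take_initSeg (X : ℕ → ℕ) (n k : ℕ) : (initSeg X n).take k = initSeg X (min k n) := by
  simp [initSeg, ← List.map_take, List.take_range]

theorem toCode_eventually (O : ℕ → ℕ) (c : OCode) :
    EvLe atTop (evalo O c) (fun j => (c.toCode (initSeg O j)).eval) := by
  induction c with
  | zero | succ | left | right => exact fun n x hx => Eventually.of_forall fun _ => hx
  | oracle =>
    intro n x hx
    filter_upwards [eventually_gt_atTop n] with j hj
    rw [OCode.eval_toCode_oracle, getElem?_initSeg hj]
    exact hx
  | pair a b iha ihb => exact iha.pair ihb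
  | comp a b iha ihb => exact iha.comp ihb
  | prec a b iha ihb => exact iha.prec ihb
  | rfind' a iha => exact iha.rfind'

theorem evalo_of_toCode_initSeg {O : ℕ → ℕ} {c : OCode} {j n x : ℕ}
    (h : x ∈ (c.toCode (initSeg O j)).eval n) : x ∈ evalo O c n := by
  refine ((evalo_of_mem_toCode (fun n v hv => ?_) c n x h).exists).choose_spec
  have hn : n < j := by
    have := (List.getElem?_eq_some_iff.1 hv).1
    simpa using this
  rw [getElem?_initSeg hn] at hv
  exact Option.some_injective _ hv

/-- The use principle. -/
theorem evalo_use {O : ℕ → ℕ} {c : OCode} {n x : ℕ} (h : x ∈ evalo O c n) :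
    ∃ m, ∀ O', initSeg O' m = initSeg O m → x ∈ evalo O' c n := by
  obtain ⟨m, hm⟩ := (toCode_eventually O c n x h).exists
  exact ⟨m, fun O' hO => evalo_of_toCode_initSeg (by rwa [hO])⟩

theorem primrec_toCode_ofNat :
    Primrec₂ fun (τ : Str) (e : ℕ) => (OCode.ofNat e).toCode τ := by
  let g : Str → List Code → Option Code := fun τ l =>
    let n := l.length - 5
    if l.length = 0 then some .zero
    else if l.length = 1 then some .succ
    else if l.length = 2 then some .left
    else if l.length = 3 then some .right
    else if l.length = 4 then some (lookupCode.curry (encode τ))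
    else
      bif n.bodd then
        bif n.div2.bodd then (l[n.div2.div2]?).map .rfind'
        else (l[n.div2.div2.unpair.1]?).bind fun a => (l[n.div2.div2.unpair.2]?).map (.prec a)
      else
        bif n.div2.bodd then
          (l[n.div2.div2.unpair.1]?).bind fun a => (l[n.div2.div2.unpair.2]?).map (.comp a)
        else (l[n.div2.div2.unpair.1]?).bind fun a => (l[n.div2.div2.unpair.2]?).map (.pair a)
  have hl : Primrec fun p : Str × List Code => p.2.length := Primrec.list_length.comp .snd
  have hn : Primrec fun p : Str × List Code => p.2.length - 5 :=
    Primrec.nat_sub.comp hl (.const 5)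
  have hd := Primrec.nat_div2.comp hn
  have hdd := Primrec.nat_div2.comp hd
  have hu := Primrec.unpair.comp hdd
  have h0 : Primrec fun p : Str × List Code => p.2[(p.2.length - 5).div2.div2]? :=
    Primrec.list_getElem?.comp .snd hdd
  have h1 : Primrec fun p : Str × List Code => p.2[(p.2.length - 5).div2.div2.unpair.1]? :=
    Primrec.list_getElem?.comp .snd (Primrec.fst.comp hu)
  have h2 : Primrec fun p : Str × List Code => p.2[(p.2.length - 5).div2.div2.unpair.2]? :=
    Primrec.list_getElem?.comp .snd (Primrec.snd.comp hu)
  have hb : ∀ {f : Code → Code → Code}, Primrec₂ f → Primrec fun p : Str × List Code =>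
      (p.2[(p.2.length - 5).div2.div2.unpair.1]?).bind fun a =>
        (p.2[(p.2.length - 5).div2.div2.unpair.2]?).map (f a) := fun {f} hf =>
    Primrec.option_bind h1 (Primrec.option_map (h2.comp .fst)
      (hf.comp (Primrec.snd.comp .fst) .snd))
  have hg : Primrec₂ g := by
    refine Primrec.ite (Primrec.eq.comp hl (.const 0)) (.const _) ?_
    refine Primrec.ite (Primrec.eq.comp hl (.const 1)) (.const _) ?_
    refine Primrec.ite (Primrec.eq.comp hl (.const 2)) (.const _) ?_
    refine Primrec.ite (Primrec.eq.comp hl (.const 3)) (.const _) ?_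
    refine Primrec.ite (Primrec.eq.comp hl (.const 4)) (Primrec.option_some.comp
      (Code.primrec₂_curry.comp (.const _) (Primrec.encode.comp .fst))) ?_
    exact Primrec.cond (Primrec.nat_bodd.comp hn)
      (Primrec.cond (Primrec.nat_bodd.comp hd)
        (Primrec.option_map h0 (Code.primrec_rfind'.comp .snd)) (hb Code.primrec₂_prec))
      (Primrec.cond (Primrec.nat_bodd.comp hd) (hb Code.primrec₂_comp) (hb Code.primrec₂_pair))
  refine Primrec.nat_strong_rec _ hg fun τ e => ?_
  match e with
  | 0 | 1 | 2 | 3 | 4 => simp [g, OCode.ofNat, OCode.toCode]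
  | n + 5 =>
    have hm : n.div2.div2 < n + 5 := by
      simp only [Nat.div2_val]
      omega
    have m1 : n.div2.div2.unpair.1 < n + 5 := lt_of_le_of_lt (Nat.unpair_left_le _) hm
    have m2 : n.div2.div2.unpair.2 < n + 5 := lt_of_le_of_lt (Nat.unpair_right_le _) hm
    rw [OCode.ofNat]
    cases h1 : n.bodd <;> cases h2 : n.div2.bodd <;>
      simp [g, h1, h2, hm, m1, m2, OCode.toCode]

/-! ### Numbers of codes and the jump -/

/-- A number of a given code. -/
def OCode.toNat : OCode → ℕ
  | .zero => 0
  | .succ => 1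
  | .left => 2
  | .right => 3
  | .oracle => 4
  | .pair a b => 2 * (2 * Nat.pair (toNat a) (toNat b)) + 5
  | .comp a b => 2 * (2 * Nat.pair (toNat a) (toNat b) + 1) + 5
  | .prec a b => 2 * (2 * Nat.pair (toNat a) (toNat b)) + 1 + 5
  | .rfind' a => 2 * (2 * toNat a + 1) + 1 + 5

theorem OCode.ofNat_toNat (c : OCode) : OCode.ofNat c.toNat = c := by
  induction c <;> rw [OCode.toNat] <;> rw [OCode.ofNat] <;>
    simp_all [Nat.div2_val]

/-- Machine `e` halts on input `e` within `|α|` steps, using an initial segment of `α` as oracle. -/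
noncomputable def haltsB (e : ℕ) (α : Str) : Bool :=
  decide (∃ j < α.length + 1,
    (Code.evaln α.length ((OCode.ofNat e).toCode (α.take j)) e).isSome = true)

theorem haltsB_mono {e : ℕ} {α β : Str} (h : α <+: β) (hα : haltsB e α = true) :
    haltsB e β = true := by
  simp only [haltsB, decide_eq_true_eq, Option.isSome_iff_exists] at hα ⊢
  obtain ⟨j, hj, x, hx⟩ := hα
  refine ⟨j, by have := h.length_le; omega, x, ?_⟩
  have : β.take j = α.take j := by
    obtain ⟨γ, rfl⟩ := h
    rw [List.take_append_of_le_length (by omega)]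
  rw [this]
  exact Code.evaln_mono h.length_le hx

theorem jump_eq_one_iff {O : ℕ → ℕ} {e : ℕ} :
    jump O e = 1 ↔ ∃ m, haltsB e (initSeg O m) = true := by
  have : jump O e = 1 ↔ ∃ x, x ∈ evalo O (OCode.ofNat e) e := by
    rw [← Part.dom_iff_mem, jump]
    split_ifs <;> simp_all
  rw [this]
  simp only [haltsB, decide_eq_true_eq, Option.isSome_iff_exists, length_initSeg, take_initSeg]
  constructor
  · rintro ⟨x, hx⟩
    obtain ⟨j, hj⟩ := (toCode_eventually O _ _ _ hx).exists
    obtain ⟨k, hk⟩ := Code.evaln_complete.1 hj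
    refine ⟨max j k, j, by omega, x, ?_⟩
    rw [min_eq_left (le_max_left _ _)]
    exact Code.evaln_mono (le_max_right _ _) hk
  · rintro ⟨m, j, hj, x, hx⟩
    exact ⟨x, evalo_of_toCode_initSeg (Code.evaln_sound hx)⟩

theorem jump_eq_zero_or_one (O : ℕ → ℕ) (e : ℕ) : jump O e = 0 ∨ jump O e = 1 := by
  rw [jump]
  split_ifs <;> simp

theorem primrec_haltsB : Primrec₂ haltsB := by
  have h : PrimrecRel fun (j : ℕ) (p : ℕ × List ℕ) =>
      (Code.evaln p.2.length ((OCode.ofNat p.1).toCode (p.2.take j)) p.1).isSome = true := by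
    refine PrimrecPred.of_eq (p := fun q : ℕ × ℕ × List ℕ => (Code.evaln q.2.2.length
      ((OCode.ofNat q.2.1).toCode (q.2.2.take q.1)) q.2.1).isSome = true) ?_ fun _ => Iff.rfl
    refine Primrec.primrecPred ?_
    have hl : Primrec fun q : ℕ × ℕ × List ℕ => q.2.2.length :=
      Primrec.list_length.comp (Primrec.snd.comp .snd)
    have hc := primrec_toCode_ofNat.comp (Primrec.list_take.comp Primrec.fst
      (Primrec.snd.comp (Primrec.snd (α := ℕ) (β := ℕ × List ℕ)))) (Primrec.fst.comp .snd)
    exact (Primrec.option_isSome.comp (Code.primrec_evaln.comp (.pair (.pair hl hc)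
      (Primrec.fst.comp .snd)))).of_eq fun q => by simp
  have hl : Primrec fun q : ℕ × List ℕ => List.range (q.2.length + 1) :=
    Primrec.list_range.comp (Primrec.succ.comp (Primrec.list_length.comp .snd))
  have h3 : PrimrecPred fun q : ℕ × List ℕ => haltsB q.1 q.2 = true := by
    refine PrimrecPred.of_eq (h.exists_mem_list.comp hl .id) ?_
    intro q
    simp [haltsB]
  obtain ⟨_, h4⟩ := h3
  exact h4.of_eq fun q => by simp

/-! ### Uniform reductions involving the jump -/

/-- A code for a constant function. -/
def OCode.const : ℕ → OCode
  | 0 => .zero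
  | n + 1 => .comp .succ (OCode.const n)

theorem evalo_const (O : ℕ → ℕ) (k n : ℕ) : evalo O (.const k) n = Part.some k := by
  induction k with
  | zero => rfl
  | succ k ih => rw [OCode.const, evalo_comp ih]; rfl

theorem primrec_toNat_const : Primrec fun k => (OCode.const k).toNat := by
  have hs : Primrec₂ fun (_ r : ℕ) => 2 * (2 * Nat.pair 1 r + 1) + 5 :=
    Primrec.nat_add.comp (Primrec.nat_mul.comp (.const 2) (Primrec.succ.comp
      (Primrec.nat_mul.comp (.const 2) (Primrec₂.natPair.comp (.const 1) .snd)))) (.const 5)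
  refine (Primrec.nat_rec₁ 0 hs).of_eq fun k => ?_
  induction k with
  | zero => rfl
  | succ k ih => simp only [ih, OCode.const, OCode.toNat]

theorem jump_toNat_eq_one_iff {O : ℕ → ℕ} {c : OCode} :
    jump O c.toNat = 1 ↔ (evalo O c c.toNat).Dom := by
  rw [jump, OCode.ofNat_toNat]
  split_ifs <;> simp_all

theorem initSeg_prefix (X : ℕ → ℕ) {m n : ℕ} (h : m ≤ n) : initSeg X m <+: initSeg X n := by
  have := List.take_prefix m (initSeg X n)
  rwa [take_initSeg, min_eq_left h] at this

theorem jump_eq_zero_iff {O : ℕ → ℕ} {e : ℕ} : jump O e = 0 ↔ ¬ jump O e = 1 := by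
  rcases jump_eq_zero_or_one O e with h | h <;> simp [h]

namespace UnifComp

variable {ι α β : Type*} [Primcodable α] [Primcodable β]
  {O O' : ι → ℕ → ℕ}

theorem exists_jump {p : ι → α × ℕ → Bool} (hp : UnifComp O p) :
    UnifComp (fun i => jump (O i)) (fun i a => decide (∃ n, p i (a, n) = true)) := by
  obtain ⟨c, hc⟩ := hp.not
  obtain ⟨d, hd⟩ := (id (O := O) (α := ℕ)).pair (const (0 : ℕ))
  let c0 : OCode := .comp (.rfind' c) d
  have h0 : ∀ i a, (evalo (O i) c0 (encode a)).Dom ↔ ∃ n, p i (a, n) = true := by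
    intro i a
    have hd' := hd i (encode a)
    simp only [encode_prod_val, encode_nat] at hd'
    have hc' : ∀ n, evalo (O i) c (Nat.pair (encode a) n) = Part.some (encode (!p i (a, n))) :=
      fun n => hc i (a, n)
    rw [evalo_comp hd']
    simp only [evalo, Nat.unpaired, Nat.unpair_pair, Nat.add_zero, hc']
    refine Nat.rfind_dom.trans ?_
    constructor
    · rintro ⟨n, hn, -⟩
      obtain ⟨z, hz, hz0⟩ := (Part.mem_map_iff _).1 hn
      refine ⟨n, ?_⟩
      rw [Part.mem_some_iff.1 hz] at hz0
      cases hpn : p i (a, n) <;> simp_all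
    · rintro ⟨n, hn⟩
      exact ⟨n, (Part.mem_map_iff _).2 ⟨0, by simp [hn], by simp⟩, fun {m} _ => by simp⟩
  let h : ℕ → ℕ := fun x => (OCode.comp c0 (.const x)).toNat
  have hh : Primrec h := by
    change Primrec fun x => 2 * (2 * Nat.pair c0.toNat (OCode.const x).toNat + 1) + 5
    exact Primrec.nat_add.comp (Primrec.nat_mul.comp (.const 2) (Primrec.succ.comp
      (Primrec.nat_mul.comp (.const 2) (Primrec₂.natPair.comp (.const _) primrec_toNat_const))))
      (.const 5)
  have key := rel (O := fun i => jump (O i)) (p := fun a b : ℕ => a = b) Primrec.eq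
    (oracle.comp (of_primrec (hh.comp (Primrec.encode (α := α))))) (const (1 : ℕ))
  convert key using 4 with i a
  rw [jump_toNat_eq_one_iff, evalo_comp (evalo_const _ _ _), h0]

theorem oracle_of_jump : UnifComp (fun i => jump (O i)) O := by
  have h := exists_jump (O := O) (p := fun i (q : (ℕ × ℕ) × ℕ) => decide (O i q.1.1 = q.1.2))
    (rel Primrec.eq (oracle.comp id.fst.fst) id.fst.snd)
  have h' := find h fun i n => ⟨O i n, by simp⟩
  convert h' using 3 with i n
  symm
  rw [Nat.find_eq_iff]
  simp
  omega

theorem of_jump {f : ι → α → β} (h : UnifComp O f) : UnifComp (fun i => jump (O i)) f :=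
  h.of_oracle oracle_of_jump

theorem haltsB {A : ℕ → ℕ} {e u : ι → α → ℕ} (hA : UnifComp O fun _ => A) (he : UnifComp O e)
    (hu : UnifComp O u) :
    UnifComp O (fun i a => haltsB (e i a) (Harrington.initSeg A (u i a))) :=
  comp₂ primrec_haltsB he (initSeg hA hu)

/-- The jump is monotone for uniform reducibility. -/
theorem jump_of_oracle (h : UnifComp O O') :
    UnifComp (fun i => jump (O i)) (fun i => jump (O' i)) := by
  have h1 := exists_jump (p := fun i (q : ℕ × ℕ) =>
    Harrington.haltsB q.1 (Harrington.initSeg (O' i) q.2))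
    (comp₂ primrec_haltsB id.fst (initSeg h id.snd))
  have h2 := h1.ite (const (1 : ℕ)) (const (0 : ℕ))
  convert h2 using 3 with i e
  rw [← jump_eq_one_iff]
  rcases jump_eq_zero_or_one (O' i) e with h | h <;> simp [h]

end UnifComp

/-! ### Continuity of computable operators -/

theorem initSeg_congr_iff {X Y : ℕ → ℕ} {m : ℕ} :
    initSeg X m = initSeg Y m ↔ ∀ i < m, X i = Y i := by
  simp [initSeg]

theorem continuousOn_of_computesFn {B : ℕ → ℕ} {c : OCode} {K : (ℕ → ℕ) → ℕ → ℕ}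
    {P : Set (ℕ → ℕ)} (h : ∀ X ∈ P, computesFn (oplus X B) c (K X)) : ContinuousOn K P := by
  refine continuousOn_pi.2 fun n X hX => ?_
  obtain ⟨m, hm⟩ := evalo_use (by rw [h X hX n]; exact Part.mem_some _)
  refine tendsto_nhds_of_eventually_eq ?_
  have hopen : {Y : ℕ → ℕ | ∀ i ∈ Finset.range m, Y i = X i} ∈ nhds X := by
    have : {Y : ℕ → ℕ | ∀ i ∈ Finset.range m, Y i = X i} =
        Set.pi (↑(Finset.range m)) fun i => {X i} := by ext; simp
    rw [this]
    exact set_pi_mem_nhds (Finset.finite_toSet _) fun i _ => by simp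
  filter_upwards [mem_nhdsWithin_of_mem_nhds hopen, self_mem_nhdsWithin] with Y hY hYP
  have h1 := hm (oplus Y B) (initSeg_congr_iff.2 fun i hi => ?_)
  · rw [h Y hYP n] at h1
    exact (Part.mem_some_iff.1 h1).symm
  · simp only [oplus]
    rw [hY (i / 2) (by simp; omega)]

/-! ### Treemaps with shifted branching -/

/-- A treemap on the full tree whose branching at each node is shifted by a constant. -/
def IsShiftMap (f : Str → Str) : Prop :=
  ∃ c : Str → ℕ, ∀ ρ i, f ρ ++ [i + c ρ] <+: f (ρ ++ [i])

namespace IsShiftMap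

variable {f g : Str → Str}

theorem mono (hf : IsShiftMap f) {ρ τ : Str} (h : ρ <+: τ) : f ρ <+: f τ := by
  obtain ⟨c, hc⟩ := hf
  obtain ⟨l, rfl⟩ := h
  induction l using List.reverseRecOn with
  | nil => simp
  | append_singleton l i ih =>
    rw [← List.append_assoc]
    exact ih.trans ((List.prefix_append _ _).trans (hc _ i))

theorem length_lt (hf : IsShiftMap f) (ρ : Str) (i : ℕ) :
    (f ρ).length < (f (ρ ++ [i])).length := by
  obtain ⟨c, hc⟩ := hf
  have := (hc ρ i).length_le
  simp at this
  omega

theorem length_le (hf : IsShiftMap f) (ρ : Str) : ρ.length ≤ (f ρ).length := by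
  induction ρ using List.reverseRecOn with
  | nil => simp
  | append_singleton l i ih =>
    have := hf.length_lt l i
    simp
    omega

theorem reflect (hf : IsShiftMap f) {ρ τ : Str} (h : f ρ <+: f τ) : ρ <+: τ := by
  induction ρ using List.reverseRecOn with
  | nil => simp
  | append_singleton ρ i ih =>
    obtain ⟨l, rfl⟩ := ih ((hf.mono (List.prefix_append _ _)).trans h)
    have hlt := hf.length_lt ρ i
    cases l with
    | nil =>
      have := h.length_le
      simp at this
      omega
    | cons j r =>
      obtain ⟨c, hc⟩ := id hf
      have h1 := (hc ρ i).trans h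
      have h2 := (hc ρ j).trans (hf.mono (τ := ρ ++ j :: r) ⟨r, by simp⟩)
      have h3 := List.prefix_of_prefix_length_le h1 h2 (by simp)
      have h4 := h3.eq_of_length (by simp)
      have : i = j := by simpa using h4
      exact ⟨r, by simp [this]⟩

theorem comp (hf : IsShiftMap f) (hg : IsShiftMap g) : IsShiftMap fun ρ => f (g ρ) := by
  obtain ⟨c, hc⟩ := id hf
  obtain ⟨d, hd⟩ := hg
  refine ⟨fun ρ => d ρ + c (g ρ), fun ρ i => ?_⟩
  rw [← Nat.add_assoc]
  exact (hc _ _).trans (hf.mono (hd ρ i))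

/-- The constant is a lower bound for the value chosen on any branch. -/
theorem le_of_prefix (hf : IsShiftMap f) {ρ τ : Str} {i : ℕ} (h : f (ρ ++ [i]) <+: τ) :
    ∃ v, τ[(f ρ).length]? = some v ∧ i ≤ v := by
  obtain ⟨c, hc⟩ := hf
  obtain ⟨l, rfl⟩ := (hc ρ i).trans h
  exact ⟨i + c ρ, by simp, by omega⟩

end IsShiftMap

/-- Redirect the part of the full tree above `σ` to the part above `σ'`, with branching at `σ'`
beyond `t`. -/
def redirect (t : ℕ) (σ σ' ρ : Str) : Str :=
  if σ <+: ρ then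
    if ρ.length ≤ σ.length then σ'
    else σ' ++ (ρ.getD σ.length 0 + t + 1) :: ρ.drop (σ.length + 1)
  else ρ

theorem redirect_self (t : ℕ) (σ σ' : Str) : redirect t σ σ' σ = σ' := by simp [redirect]

theorem redirect_append (t : ℕ) (σ σ' r : Str) (i : ℕ) :
    redirect t σ σ' (σ ++ i :: r) = σ' ++ (i + t + 1) :: r := by
  simp [redirect]

theorem redirect_of_not_prefix {t : ℕ} {σ σ' ρ : Str} (h : ¬ σ <+: ρ) :
    redirect t σ σ' ρ = ρ := by simp [redirect, h]

theorem isShiftMap_redirect {t : ℕ} {σ σ' : Str} (h : σ <+: σ') :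
    IsShiftMap (redirect t σ σ') := by
  refine ⟨fun ρ => if ρ = σ then t + 1 else 0, fun ρ i => ?_⟩
  by_cases h1 : σ <+: ρ
  · obtain ⟨r, rfl⟩ := h1
    cases r with
    | nil => simp [redirect_self, redirect_append, Nat.add_assoc]
    | cons a r => simp [redirect_append]
  · have hne : ρ ≠ σ := by rintro rfl; simp at h1
    simp only [redirect_of_not_prefix h1, if_neg hne]
    by_cases h2 : σ <+: ρ ++ [i]
    · rcases List.prefix_concat_iff.1 h2 with rfl | h3
      · rwa [redirect_self]
      · exact absurd h3 h1
    · rw [redirect_of_not_prefix h2]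
      simp

/-- `σ` is an initial segment of `Y`. -/
def InitOf (σ : Str) (Y : ℕ → ℕ) : Prop := initSeg Y σ.length = σ

theorem initOf_initSeg (Y : ℕ → ℕ) (n : ℕ) : InitOf (initSeg Y n) Y := by simp [InitOf]

theorem InitOf.prefix_initSeg {σ : Str} {Y : ℕ → ℕ} (h : InitOf σ Y) {n : ℕ}
    (hn : σ.length ≤ n) : σ <+: initSeg Y n := by
  rw [← h]
  exact initSeg_prefix _ hn

theorem initOf_iff {σ : Str} {Y : ℕ → ℕ} :
    InitOf σ Y ↔ ∀ k < σ.length, σ[k]? = some (Y k) := by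
  rw [InitOf]
  refine ⟨fun h k hk => by rw [← h, getElem?_initSeg hk], fun h => ?_⟩
  refine List.ext_getElem? fun k => ?_
  by_cases hk : k < σ.length
  · rw [h k hk, getElem?_initSeg hk]
  · rw [List.getElem?_eq_none (by simpa using hk), List.getElem?_eq_none (by simpa using hk)]

theorem InitOf.of_prefix {σ τ : Str} {Y : ℕ → ℕ} (h : InitOf τ Y) (hσ : σ <+: τ) :
    InitOf σ Y := by
  obtain ⟨r, rfl⟩ := hσ
  rw [initOf_iff] at h ⊢
  intro k hk
  have := h k (by simp; omega)
  rwa [List.getElem?_append_left hk] at this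

theorem InitOf.prefix {σ τ : Str} {Y : ℕ → ℕ} (hσ : InitOf σ Y) (hτ : InitOf τ Y)
    (h : σ.length ≤ τ.length) : σ <+: τ := by
  rw [← hτ]
  exact hσ.prefix_initSeg h

theorem InitOf.ext {X Y : ℕ → ℕ} {f : ℕ → Str} (hl : ∀ n, n ≤ (f n).length)
    (hX : ∀ n, InitOf (f n) X) (hY : ∀ n, InitOf (f n) Y) : X = Y := by
  funext n
  have h1 := initOf_iff.1 (hX (n + 1)) n (hl (n + 1))
  rw [initOf_iff.1 (hY (n + 1)) n (hl (n + 1))] at h1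
  simpa using h1.symm

namespace IsShiftMap

variable {f g : Str → Str}

theorem initOf_pathMap (hf : IsShiftMap f) (X : ℕ → ℕ) (n : ℕ) :
    InitOf (f (initSeg X n)) (pathMap f X) := by
  refine initOf_iff.2 fun k hk => ?_
  have hk' : k < (f (initSeg X (k + 1))).length := by
    have := hf.length_le (initSeg X (k + 1))
    simp at this
    omega
  have : (f (initSeg X n))[k]? = (f (initSeg X (k + 1)))[k]? := by
    rcases le_total n (k + 1) with h | h
    · obtain ⟨r, hr⟩ := hf.mono (initSeg_prefix X h)
      rw [← hr, List.getElem?_append_left hk]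
    · obtain ⟨r, hr⟩ := hf.mono (initSeg_prefix X h)
      rw [← hr, List.getElem?_append_left hk']
  rw [this, pathMap, List.getD_eq_getElem?_getD, List.getElem?_eq_getElem hk']
  rfl

theorem eq_pathMap (hf : IsShiftMap f) {X Y : ℕ → ℕ} (h : ∀ n, InitOf (f (initSeg X n)) Y) :
    Y = pathMap f X :=
  InitOf.ext (fun n => by simpa using hf.length_le (initSeg X n)) h (hf.initOf_pathMap X)

theorem initOf_of_initOf_pathMap (hf : IsShiftMap f) {X : ℕ → ℕ} {ρ : Str}
    (h : InitOf (f ρ) (pathMap f X)) : InitOf ρ X := by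
  have h1 := h.prefix (hf.initOf_pathMap X (f ρ).length)
    (by simpa using hf.length_le (initSeg X (f ρ).length))
  exact (initOf_initSeg _ _).of_prefix (hf.reflect h1)

end IsShiftMap

/-! ### The forcing construction -/

/-- No initial segment of `ρ` with sum at most `t` has left the tree `T`. -/
def Alive (T : Str → Bool) (t : ℕ) (ρ : Str) : Prop :=
  ∀ τ, τ <+: ρ → τ.sum ≤ t → T τ = true

theorem alive_redirect {T : Str → Bool} {t : ℕ} {σ σ' ρ : Str} (hσ' : Alive T t σ')
    (hρ : Alive T (t + 1) ρ) : Alive T t (redirect t σ σ' ρ) := by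
  by_cases h : σ <+: ρ
  · obtain ⟨r, rfl⟩ := h
    cases r with
    | nil => simpa [redirect_self] using hσ'
    | cons i r =>
      rw [redirect_append]
      intro τ hτ hs
      rcases List.prefix_or_prefix_of_prefix hτ (List.prefix_append _ _) with h | ⟨l, rfl⟩
      · exact hσ' τ h hs
      · cases l with
        | nil => exact hσ' _ (by simp) hs
        | cons j l =>
          rw [List.prefix_append_right_inj, List.cons_prefix_cons] at hτ
          simp only [List.sum_append, List.sum_cons] at hs
          omega
  · rw [redirect_of_not_prefix h]
    exact fun τ hτ hs => hρ τ hτ (by omega)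

/-- The requirement `(σ, σ')` considered at stage `t`. -/
def request (t : ℕ) : Str × Str := (decode (α := Str × Str) t.unpair.1).getD ([], [])

/-- The composition of a list of redirections, the first entry being applied first. -/
def run (L : List (ℕ × Str × Str)) (ρ : Str) : Str :=
  L.foldl (fun ρ a => redirect a.1 a.2.1 a.2.2 ρ) ρ

/-- The request at stage `t` is to be granted. -/
def Grant (T : Str → Bool) (C : ℕ → Str → Bool) (L : List (ℕ × Str × Str)) (t : ℕ) : Prop :=
  (request t).1 <+: (request t).2 ∧ C (request t).1.length (run L (request t).2) = true ∧
    C (request t).1.length (run L (request t).1) = false ∧ Alive T t (request t).2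

/-- The redirections made before stage `t`, last one first. -/
noncomputable def stage (T : Str → Bool) (C : ℕ → Str → Bool) : ℕ → List (ℕ × Str × Str)
  | 0 => []
  | t + 1 => if Grant T C (stage T C t) t then (t, request t) :: stage T C t else stage T C t

/-- The approximation at stage `t` to the treemap. -/
noncomputable def approx (T : Str → Bool) (C : ℕ → Str → Bool) (t : ℕ) : Str → Str :=
  run (stage T C t)

section Construction

variable {T : Str → Bool} {C : ℕ → Str → Bool}

theorem approx_zero (ρ : Str) : approx T C 0 ρ = ρ := rfl

theorem approx_succ_of_grant {t : ℕ} (h : Grant T C (stage T C t) t) (ρ : Str) :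
    approx T C (t + 1) ρ = approx T C t (redirect t (request t).1 (request t).2 ρ) := by
  simp [approx, stage, h, run]

theorem approx_succ_of_not_grant {t : ℕ} (h : ¬ Grant T C (stage T C t) t) :
    approx T C (t + 1) = approx T C t := by
  simp [approx, stage, h]

theorem isShiftMap_approx (t : ℕ) : IsShiftMap (approx T C t) := by
  induction t with
  | zero => exact ⟨fun _ => 0, fun ρ i => by simp [approx_zero]⟩
  | succ t ih =>
    by_cases h : Grant T C (stage T C t) t
    · rw [funext (approx_succ_of_grant h)]
      exact ih.comp (isShiftMap_redirect h.1)
    · rwa [approx_succ_of_not_grant h]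

theorem approx_succ_of_not_prefix {t : ℕ} {σ : Str}
    (h : Grant T C (stage T C t) t → ¬ (request t).1 <+: σ) :
    approx T C (t + 1) σ = approx T C t σ := by
  by_cases hg : Grant T C (stage T C t) t
  · rw [approx_succ_of_grant hg, redirect_of_not_prefix (h hg)]
  · rw [approx_succ_of_not_grant hg]

theorem settled_of_proper {σ : Str} {t₀ : ℕ} (h : ∀ s ≥ t₀, Grant T C (stage T C s) s →
    (request s).1 <+: σ → (request s).1 = σ) :
    ∃ t₁, ∀ s ≥ t₁, Grant T C (stage T C s) s → ¬ (request s).1 <+: σ := by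
  by_cases hs : ∃ s ≥ t₀, Grant T C (stage T C s) s ∧ (request s).1 = σ
  · obtain ⟨s, hs, hg, rfl⟩ := hs
    have key : ∀ u ≥ s + 1, C (request s).1.length (approx T C u (request s).1) = true := by
      intro u hu
      induction u, hu using Nat.le_induction with
      | base =>
        rw [approx_succ_of_grant hg, redirect_self]
        exact hg.2.1
      | succ u hu ih =>
        rwa [approx_succ_of_not_prefix]
        intro hgu hp
        have h1 := h u (by omega) hgu hp
        have h2 := hgu.2.2.1
        rw [h1] at h2
        exact absurd (ih.symm.trans h2) (by simp)
    refine ⟨s + 1, fun u hu hgu hp => ?_⟩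
    have h1 := h u (by omega) hgu hp
    have h2 := hgu.2.2.1
    rw [h1] at h2
    exact absurd ((key u hu).symm.trans h2) (by simp)
  · exact ⟨t₀, fun s hs' hg hp => hs ⟨s, hs', hg, h s hs' hg hp⟩⟩

variable (T C) in
theorem exists_settled (σ : Str) :
    ∃ t₀, ∀ s ≥ t₀, Grant T C (stage T C s) s → ¬ (request s).1 <+: σ := by
  induction σ using List.reverseRecOn with
  | nil => exact settled_of_proper (t₀ := 0) fun s _ _ h => List.prefix_nil.1 h
  | append_singleton σ i ih =>
    obtain ⟨t₀, h⟩ := ih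
    exact settled_of_proper (t₀ := t₀) fun s hs hg hp =>
      (List.prefix_concat_iff.1 hp).resolve_right (h s hs hg)

variable (T C) in
theorem exists_modulus (σ : Str) : ∃ t, ∀ s, approx T C (t + s) σ = approx T C t σ := by
  obtain ⟨t, ht⟩ := exists_settled T C σ
  refine ⟨t, fun s => ?_⟩
  induction s with
  | zero => rfl
  | succ s ih => rw [← ih, ← Nat.add_assoc, approx_succ_of_not_prefix (ht _ (by omega))]

variable (T C) in
/-- The least stage at which the approximation at `σ` has settled. -/
noncomputable def modulus (σ : Str) : ℕ := Nat.find (exists_modulus T C σ)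

variable (T C) in
/-- The limit of the approximations. -/
noncomputable def limit (σ : Str) : Str := approx T C (modulus T C σ) σ

theorem approx_eq_limit {σ : Str} {t : ℕ} (h : modulus T C σ ≤ t) :
    approx T C t σ = limit T C σ := by
  obtain ⟨s, rfl⟩ := Nat.exists_eq_add_of_le h
  exact Nat.find_spec (exists_modulus T C σ) s

theorem isShiftMap_limit : IsShiftMap (limit T C) := by
  choose t ht using exists_settled T C
  choose c hc using fun u => isShiftMap_approx (T := T) (C := C) u
  refine ⟨fun ρ => c (t ρ) ρ, fun ρ i => ?_⟩
  have h1 : ∀ s, approx T C (t ρ + s) ρ = approx T C (t ρ) ρ := by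
    intro s
    induction s with
    | zero => rfl
    | succ s ih => rw [← ih, ← Nat.add_assoc, approx_succ_of_not_prefix (ht _ _ (by omega))]
  have h2 : ∀ s, approx T C (t ρ) (ρ ++ [i]) <+: approx T C (t ρ + s) (ρ ++ [i]) := by
    intro s
    induction s with
    | zero => simp
    | succ s ih =>
      refine ih.trans ?_
      rw [← Nat.add_assoc]
      by_cases hg : Grant T C (stage T C (t ρ + s)) (t ρ + s)
      · by_cases hp : (request (t ρ + s)).1 <+: ρ ++ [i]
        · have h3 := (List.prefix_concat_iff.1 hp).resolve_right (ht ρ _ (by omega) hg)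
          rw [approx_succ_of_grant hg, ← h3, redirect_self]
          exact (isShiftMap_approx _).mono hg.1
        · rw [approx_succ_of_not_prefix fun _ => hp]
      · rw [approx_succ_of_not_grant hg]
  rw [← approx_eq_limit (t := t ρ + (modulus T C ρ + modulus T C (ρ ++ [i]))) (by omega),
    ← approx_eq_limit (t := t ρ + (modulus T C ρ + modulus T C (ρ ++ [i]))) (by omega), h1]
  exact (hc _ ρ i).trans (h2 _)

theorem exists_alive {X : ℕ → ℕ} (hX : ∀ n, T (initSeg X n) = true) (t n : ℕ) :
    ∃ ζ, Alive T t ζ ∧ approx T C t ζ = limit T C (initSeg X n) := by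
  suffices h : ∀ d t, modulus T C (initSeg X n) ≤ t + d →
      ∃ ζ, Alive T t ζ ∧ approx T C t ζ = limit T C (initSeg X n) from h _ t (Nat.le_add_left _ _)
  intro d
  induction d with
  | zero =>
    intro t ht
    refine ⟨initSeg X n, fun τ hτ _ => ?_, approx_eq_limit ht⟩
    rw [← (initOf_initSeg X n).of_prefix hτ]
    exact hX _
  | succ d ih =>
    intro t ht
    obtain ⟨ζ, h1, h2⟩ := ih (t + 1) (by omega)
    by_cases hg : Grant T C (stage T C t) t
    · exact ⟨_, alive_redirect hg.2.2.2 h1, by rw [← h2, approx_succ_of_grant hg]⟩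
    · rw [approx_succ_of_not_grant hg] at h2
      exact ⟨ζ, fun τ hτ hs => h1 τ hτ (by omega), h2⟩

/-- The limit treemap forces the requirement `C`. -/
theorem exists_iff_limit (hC : ∀ e σ τ, σ <+: τ → C e σ = true → C e τ = true)
    {X : ℕ → ℕ} (hX : ∀ n, T (initSeg X n) = true) (e : ℕ) :
    (∃ m, C e (initSeg (pathMap (limit T C) X) m) = true) ↔
      C e (limit T C (initSeg X e)) = true := by
  have hF := isShiftMap_limit (T := T) (C := C)
  refine ⟨fun ⟨m, hm⟩ => ?_, fun h => ⟨_, by rwa [hF.initOf_pathMap X e]⟩⟩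
  by_contra hne
  obtain ⟨t, ht⟩ := exists_settled T C (initSeg X e)
  let n := max m e
  let s := Nat.pair (encode (initSeg X e, initSeg X n))
    (max t (max (modulus T C (initSeg X e)) (modulus T C (initSeg X n))))
  have hs := Nat.right_le_pair (encode (initSeg X e, initSeg X n))
    (max t (max (modulus T C (initSeg X e)) (modulus T C (initSeg X n))))
  have hr : request s = (initSeg X e, initSeg X n) := by
    simp only [request, s, Nat.unpair_pair, encodek, Option.getD_some]
  refine ht s (by omega) ⟨?_, ?_, ?_, ?_⟩ (by rw [hr]) <;> rw [hr]
  · exact initSeg_prefix X (le_max_right _ _)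
  · change C _ (approx T C s (initSeg X n)) = true
    rw [approx_eq_limit (by omega), length_initSeg]
    refine hC _ _ _ ((initOf_initSeg _ m).prefix (hF.initOf_pathMap X n) ?_) hm
    have := hF.length_le (initSeg X n)
    simp [n] at this ⊢
    omega
  · change C _ (approx T C s (initSeg X e)) = false
    rw [approx_eq_limit (by omega), length_initSeg]
    simpa using hne
  · intro τ hτ _
    rw [← (initOf_initSeg X n).of_prefix hτ]
    exact hX _

variable (T C) in
/-- The points all of whose approximate preimages can be extended inside `T`. -/
def imageSet : Set (ℕ → ℕ) :=
  {Y | ∀ t ρ, InitOf (approx T C t []) Y ∧ (InitOf (approx T C t ρ) Y →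
    (ρ.sum ≤ t → T ρ = true) ∧ ∃ i, InitOf (approx T C t (ρ ++ [i])) Y)}

theorem IsShiftMap.le_of_initOf {f : Str → Str} (hf : IsShiftMap f) {ρ : Str} {i : ℕ}
    {Y : ℕ → ℕ} (h : InitOf (f (ρ ++ [i])) Y) : i ≤ Y (f ρ).length := by
  obtain ⟨v, h1, h2⟩ := hf.le_of_prefix (List.prefix_refl (f (ρ ++ [i])))
  rw [initOf_iff.1 h _ (hf.length_lt ρ i)] at h1
  obtain rfl := Option.some_injective _ h1
  exact h2

theorem pathMap_mem_imageSet {X : ℕ → ℕ} (hX : ∀ n, T (initSeg X n) = true) :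
    pathMap (limit T C) X ∈ imageSet T C := by
  have hF := isShiftMap_limit (T := T) (C := C)
  have hA := fun t => isShiftMap_approx (T := T) (C := C) t
  have hY := hF.initOf_pathMap X
  intro t ρ
  constructor
  · obtain ⟨ζ, -, h⟩ := exists_alive (C := C) hX t 0
    exact (h ▸ hY 0).of_prefix ((hA t).mono (List.nil_prefix))
  · intro hρ
    obtain ⟨ζ, h1, h2⟩ := exists_alive (C := C) hX t ((approx T C t ρ).length + 1)
    have hl := hF.length_le (initSeg X ((approx T C t ρ).length + 1))
    rw [length_initSeg] at hl
    have hi : InitOf (approx T C t ζ) (pathMap (limit T C) X) := h2 ▸ hY _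
    obtain ⟨r, rfl⟩ := (hA t).reflect (hρ.prefix hi (by rw [h2]; omega))
    refine ⟨fun hs => h1 ρ (List.prefix_append _ _) hs, ?_⟩
    cases r with
    | nil =>
      rw [List.append_nil] at h2
      rw [← h2] at hl
      omega
    | cons i r => exact ⟨i, hi.of_prefix ((hA t).mono ⟨r, by simp⟩)⟩

theorem exists_of_mem_imageSet {Y : ℕ → ℕ} (hY : Y ∈ imageSet T C) :
    ∃ X, (∀ n, T (initSeg X n) = true) ∧ Y = pathMap (limit T C) X := by
  have hF := isShiftMap_limit (T := T) (C := C)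
  have hA := fun t => isShiftMap_approx (T := T) (C := C) t
  have hnext : ∀ ρ, ∃ i, InitOf (limit T C ρ) Y → InitOf (limit T C (ρ ++ [i])) Y := by
    intro ρ
    by_cases h : InitOf (limit T C ρ) Y
    swap
    · exact ⟨0, fun h' => absurd h' h⟩
    let t := max (modulus T C ρ)
      ((Finset.range (Y (limit T C ρ).length + 1)).sup fun i => modulus T C (ρ ++ [i]))
    have ht : approx T C t ρ = limit T C ρ := approx_eq_limit (le_max_left _ _)
    obtain ⟨i, hi⟩ := ((hY t ρ).2 (by rwa [ht])).2
    have hle := (hA t).le_of_initOf hi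
    rw [ht] at hle
    refine ⟨i, fun _ => ?_⟩
    rwa [approx_eq_limit] at hi
    exact (Finset.le_sup (f := fun i => modulus T C (ρ ++ [i]))
      (Finset.mem_range.2 (Nat.lt_succ_of_le hle))).trans (le_max_right _ _)
  choose next hnext using hnext
  let g : ℕ → Str := fun n => Nat.rec [] (fun _ ρ => ρ ++ [next ρ]) n
  have hg : ∀ n, initSeg (fun n => next (g n)) n = g n := by
    intro n
    induction n with
    | zero => rfl
    | succ n ih =>
      have h1 : initSeg (fun n => next (g n)) (n + 1) = initSeg (fun n => next (g n)) n ++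
        [next (g n)] := by simp [initSeg, List.range_succ]
      rw [h1, ih]
  have hgY : ∀ n, InitOf (limit T C (g n)) Y := by
    intro n
    induction n with
    | zero => exact (hY (modulus T C []) []).1
    | succ n ih => exact hnext _ ih
  refine ⟨fun n => next (g n), fun n => ?_, hF.eq_pathMap fun n => by rw [hg]; exact hgY n⟩
  rw [hg]
  refine ((hY (max (modulus T C (g n)) (g n).sum) (g n)).2 ?_).1 (le_max_right _ _)
  rw [approx_eq_limit (le_max_left _ _)]
  exact hgY n

variable (T C) in
theorem imageSet_eq : imageSet T C = pathMap (limit T C) '' {X | ∀ n, T (initSeg X n) = true} :=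
  Set.Subset.antisymm
    (fun _ hY => let ⟨X, hX, h⟩ := exists_of_mem_imageSet hY; ⟨X, hX, h.symm⟩)
    (by rintro _ ⟨X, hX, rfl⟩; exact pathMap_mem_imageSet hX)

end Construction

/-! ### Computability of the construction -/

theorem primrec_prefix : PrimrecRel fun σ τ : List ℕ => σ <+: τ := by
  refine PrimrecPred.of_eq (p := fun q : List ℕ × List ℕ => q.1 = q.2.take q.1.length)
    (Primrec.eq.comp .fst (Primrec.list_take.comp (Primrec.list_length.comp .fst) .snd))
    fun q => List.prefix_iff_eq_take.symm

theorem primrec_sum : Primrec fun σ : List ℕ => σ.sum :=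
  (Primrec.list_foldr .id (.const 0) (h := fun _ q => q.1 + q.2)
    (Primrec.nat_add.comp (Primrec.fst.comp .snd) (Primrec.snd.comp .snd))).of_eq fun _ => rfl

theorem primrec_redirect :
    Primrec fun q : ℕ × List ℕ × List ℕ × List ℕ => redirect q.1 q.2.1 q.2.2.1 q.2.2.2 := by
  have t : Primrec fun q : ℕ × List ℕ × List ℕ × List ℕ => q.1 := .fst
  have σ : Primrec fun q : ℕ × List ℕ × List ℕ × List ℕ => q.2.1 := Primrec.fst.comp .snd
  have σ' : Primrec fun q : ℕ × List ℕ × List ℕ × List ℕ => q.2.2.1 :=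
    Primrec.fst.comp (Primrec.snd.comp .snd)
  have ρ : Primrec fun q : ℕ × List ℕ × List ℕ × List ℕ => q.2.2.2 :=
    Primrec.snd.comp (Primrec.snd.comp .snd)
  have lσ := Primrec.list_length.comp σ
  have h := Primrec.ite (primrec_prefix.comp σ ρ)
    (Primrec.ite (Primrec.nat_le.comp (Primrec.list_length.comp ρ) lσ) σ'
      (Primrec.list_append.comp σ' (Primrec.list_cons.comp
        (Primrec.succ.comp (Primrec.nat_add.comp ((Primrec.list_getD 0).comp ρ lσ) t))
        (Primrec.list_drop.comp (Primrec.succ.comp lσ) ρ)))) ρ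
  refine h.of_eq fun q => ?_
  simp [redirect]

theorem primrec_run : Primrec₂ run := by
  have h := Primrec.list_foldl (f := fun q : List (ℕ × List ℕ × List ℕ) × List ℕ => q.1)
    (g := fun q => q.2) (h := fun _ q => redirect q.2.1 q.2.2.1 q.2.2.2 q.1) .fst .snd
    (primrec_redirect.comp (.pair (Primrec.fst.comp (Primrec.snd.comp .snd)) (.pair
      (Primrec.fst.comp (Primrec.snd.comp (Primrec.snd.comp .snd))) (.pair
      (Primrec.snd.comp (Primrec.snd.comp (Primrec.snd.comp .snd))) (Primrec.fst.comp .snd)))))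
  exact h

theorem primrec_request : Primrec request :=
  Primrec.option_getD.comp (Primrec.decode.comp (Primrec.fst.comp .unpair)) (.const _)

namespace UnifComp

variable {ι : Type*} {O : ι → ℕ → ℕ} {T : Str → Bool} {C : ℕ → Str → Bool}

theorem alive (hT : UnifComp O fun _ => T) :
    UnifComp O fun _ (q : ℕ × Str) => decide (Alive T q.1 q.2) := by
  have h1 : UnifComp O fun _ (q : (ℕ × Str) × ℕ) => q.1.2.take q.2 :=
    of_primrec (Primrec.list_take.comp .snd (Primrec.snd.comp .fst))
  have h := forall_lt (((rel Primrec.nat_le (comp₁ primrec_sum h1) id.fst.fst).not).or (hT.comp h1))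
    (of_primrec (O := O) (Primrec.succ.comp (Primrec.list_length.comp (Primrec.snd (α := ℕ)))))
  convert h using 4 with i q
  refine ⟨fun h k _ => ?_, fun h τ hτ hs => ?_⟩
  · by_cases hs : (q.2.take k).sum ≤ q.1
    · simp [hs, h _ (List.take_prefix k q.2) hs]
    · simp [hs]
  · have := h τ.length (Nat.lt_succ_of_le hτ.length_le)
    rw [← List.prefix_iff_eq_take.1 hτ] at this
    simpa [hs] using this

theorem stage (hT : UnifComp O fun _ => T) (hC : UnifComp O fun _ (q : ℕ × Str) => C q.1 q.2) :
    UnifComp O fun _ => stage T C := by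
  have t : UnifComp O fun _ (q : ℕ × ℕ × List (ℕ × Str × Str)) => q.2.1 := id.snd.fst
  have L : UnifComp O fun _ (q : ℕ × ℕ × List (ℕ × Str × Str)) => q.2.2 := id.snd.snd
  have r := comp₁ primrec_request t
  have len := comp₁ Primrec.list_length r.fst
  have grant := (rel primrec_prefix r.fst r.snd).and
    ((hC.comp (len.pair (comp₂ primrec_run L r.snd))).and
      ((hC.comp (len.pair (comp₂ primrec_run L r.fst))).not.and
        ((alive hT).comp (t.pair r.snd))))
  have h := nat_rec (const (O := O) (α := ℕ) ([] : List (ℕ × Str × Str)))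
    (grant.ite (comp₂ Primrec.list_cons (t.pair r) L) L) id
  convert h using 3 with i n
  induction n with
  | zero => rfl
  | succ n ih =>
    simp only [← ih, Harrington.stage]
    by_cases hg : Grant T C (Harrington.stage T C n) n
    · rw [if_pos hg]
      obtain ⟨h1, h2, h3, h4⟩ := hg
      simp [h1, h2, h3, h4]
    · rw [if_neg hg, cond_eq_ite, if_neg]
      simpa [Grant] using hg

theorem approx (hT : UnifComp O fun _ => T) (hC : UnifComp O fun _ (q : ℕ × Str) => C q.1 q.2) :
    UnifComp O fun _ (q : ℕ × Str) => approx T C q.1 q.2 :=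
  comp₂ (h := run) primrec_run ((stage hT hC).comp id.fst) id.snd

theorem limit {A : ℕ → ℕ} (hT : UnifComp (fun _ : Unit => A) fun _ => T)
    (hC : UnifComp (fun _ : Unit => A) fun _ (q : ℕ × Str) => C q.1 q.2) :
    UnifComp (fun _ : Unit => jump A) fun _ => limit T C := by
  have ha := approx hT hC
  have h1 := exists_jump (O := fun _ : Unit => A) (α := Str × ℕ)
    (p := fun _ q => !decide (Harrington.approx T C (q.1.2 + q.2) q.1.1 =
      Harrington.approx T C q.1.2 q.1.1))
    (rel Primrec.eq (ha.comp ((comp₂ Primrec.nat_add id.fst.snd id.snd).pair id.fst.fst))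
      (ha.comp (id.fst.snd.pair id.fst.fst))).not
  have hm := find h1.not (fun _ σ => by simpa using exists_modulus T C σ)
  have h2 := ha.of_jump.comp (hm.pair id)
  convert h2 using 4
  simp [Harrington.limit, modulus]

end UnifComp

/-! ### The image is a `Π⁰₁` class -/

theorem isPi01In_of_forall {A : ℕ → ℕ} {V : Str → Bool}
    (hV : UnifComp (fun _ : Unit => A) fun _ => V) :
    IsPi01In A {Y | ∀ n, V (initSeg Y n) = true} := by
  refine ⟨{τ | ∀ k < τ.length + 1, V (τ.take k) = true}, ?_, ?_, ?_⟩
  · intro σ τ h hτ k hk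
    have := hτ k (by have := h.length_le; omega)
    obtain ⟨r, rfl⟩ := h
    rwa [List.take_append_of_le_length (by omega)] at this
  · have h1 := UnifComp.forall_lt (hV.comp (UnifComp.of_primrec (O := fun _ : Unit => A)
      (f := fun q : Str × ℕ => q.1.take q.2) (Primrec.list_take.comp .snd .fst)))
      (UnifComp.of_primrec (Primrec.succ.comp Primrec.list_length))
    obtain ⟨c, hc⟩ := h1.ite (UnifComp.const (1 : ℕ)) (UnifComp.const (0 : ℕ))
    refine ⟨c, fun σ => ?_⟩
    rw [hc () σ]
    simp [chi, cond_eq_ite]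
  · ext Y
    simp only [paths, Set.mem_ofPred_eq, length_initSeg, take_initSeg]
    refine ⟨fun h n k _ => h _, fun h n => ?_⟩
    simpa using h n n (by omega)

/-- The string `τ` witnesses that none of its extensions is in the image. -/
def Bad (T : Str → Bool) (C : ℕ → Str → Bool) (t : ℕ) (ρ τ : Str) : Prop :=
  ((approx T C t []).length ≤ τ.length ∧ ¬ approx T C t [] <+: τ) ∨
    (approx T C t ρ <+: τ ∧ ((ρ.sum ≤ t ∧ ¬ T ρ = true) ∨
      ((approx T C t ρ).length < τ.length ∧ ∀ i < τ.getD (approx T C t ρ).length 0 + 1,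
        (approx T C t (ρ ++ [i])).length ≤ τ.length ∧ ¬ approx T C t (ρ ++ [i]) <+: τ)))

/-- The pair of a stage and a string to be examined at a given level. -/
def probe (n : ℕ) : ℕ × Str := (decode (α := ℕ × Str) n.unpair.1).getD (0, [])

theorem UnifComp.bad {ι : Type*} {O : ι → ℕ → ℕ} {T : Str → Bool} {C : ℕ → Str → Bool}
    (hT : UnifComp O fun _ => T) (hC : UnifComp O fun _ (q : ℕ × Str) => C q.1 q.2) :
    UnifComp O fun _ (τ : Str) => decide (Bad T C (probe τ.length).1 (probe τ.length).2 τ) := by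
  have ha := approx hT hC
  have len : UnifComp O fun _ (τ : Str) => τ.length := of_primrec Primrec.list_length
  have hp : UnifComp O fun _ (τ : Str) => probe τ.length :=
    comp₁ (Primrec.option_getD.comp (Primrec.decode.comp (Primrec.fst.comp .unpair)) (.const _)) len
  have h0 := ha.comp (hp.fst.pair (const ([] : Str)))
  have h1 := ha.comp (hp.fst.pair hp.snd)
  have l1 := comp₁ Primrec.list_length h1
  have hx : UnifComp O fun _ (q : Str × ℕ) => q.1 := id.fst
  have h2 := ha.comp ((hp.comp hx).fst.pair (comp₂ (h := fun (l : Str) i => l ++ [i])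
    Primrec.list_concat (hp.comp hx).snd id.snd))
  have hall := forall_lt ((rel Primrec.nat_le (comp₁ Primrec.list_length h2) (len.comp hx)).and
    (rel primrec_prefix h2 hx).not) (comp₁ Primrec.succ (comp₂ (Primrec.list_getD 0) id l1))
  have h := ((rel Primrec.nat_le (comp₁ Primrec.list_length h0) len).and
    (rel primrec_prefix h0 id).not).or ((rel primrec_prefix h1 id).and
      (((rel Primrec.nat_le (comp₁ primrec_sum hp.snd) hp.fst).and (hT.comp hp.snd).not).or
        ((rel Primrec.nat_lt l1 len).and hall)))
  convert h using 3 with i τ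
  rw [Bool.eq_iff_iff]
  simp [Bad]

theorem imageSet_eq_forall (T : Str → Bool) (C : ℕ → Str → Bool) : imageSet T C = {Y | ∀ n,
    (!decide (Bad T C (probe (initSeg Y n).length).1 (probe (initSeg Y n).length).2
      (initSeg Y n))) = true} := by
  have hA := fun t => isShiftMap_approx (T := T) (C := C) t
  have hpre : ∀ {σ Y k}, σ <+: initSeg Y k → InitOf σ Y :=
    fun h => (initOf_initSeg _ _).of_prefix h
  ext Y
  simp only [Set.mem_ofPred_eq, length_initSeg, Bool.not_eq_true', decide_eq_false_iff_not]
  constructor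
  · intro hY n
    generalize probe n = p
    have hpre' : ∀ {σ}, InitOf σ Y → σ.length ≤ n → σ <+: initSeg Y n := fun h => h.prefix_initSeg
    rintro (⟨h1, h2⟩ | ⟨h1, ⟨h2, h3⟩ | ⟨h2, h3⟩⟩)
    · exact h2 (hpre' (hY p.1 []).1 (by simpa using h1))
    · exact h3 (((hY p.1 p.2).2 (hpre h1)).1 h2)
    · obtain ⟨i, hi⟩ := ((hY p.1 p.2).2 (hpre h1)).2
      have h4 := (hA p.1).le_of_initOf hi
      rw [length_initSeg] at h2
      rw [List.getD_eq_getElem?_getD, getElem?_initSeg h2] at h3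
      obtain ⟨h5, h6⟩ := h3 i (Nat.lt_succ_of_le h4)
      exact h6 (hpre' hi (by simpa using h5))
  · intro h t ρ
    have hbad : ∀ m, ∃ k ≥ m, ¬ Bad T C t ρ (initSeg Y k) := by
      intro m
      refine ⟨Nat.pair (encode (t, ρ)) m, Nat.right_le_pair _ _, ?_⟩
      have := h (Nat.pair (encode (t, ρ)) m)
      rwa [show probe (Nat.pair (encode (t, ρ)) m) = (t, ρ) by
        simp only [probe, Nat.unpair_pair, encodek, Option.getD_some]] at this
    constructor
    · obtain ⟨k, hk, hb⟩ := hbad (approx T C t []).length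
      by_contra hne
      exact hb (Or.inl ⟨by simpa using hk, fun h => hne (hpre h)⟩)
    · intro hρ
      obtain ⟨k, hk, hb⟩ := hbad (max ((approx T C t ρ).length + 1)
        ((Finset.range (Y (approx T C t ρ).length + 1)).sup
          fun i => (approx T C t (ρ ++ [i])).length))
      have hk1 : (approx T C t ρ).length < k := by omega
      have hρk := hρ.prefix_initSeg hk1.le
      constructor
      · intro hs
        by_contra hT
        exact hb (Or.inr ⟨hρk, Or.inl ⟨hs, hT⟩⟩)
      · by_contra! hi
        refine hb (Or.inr ⟨hρk, Or.inr ⟨by simpa using hk1, fun i hiY => ?_⟩⟩)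
        rw [List.getD_eq_getElem?_getD, getElem?_initSeg hk1] at hiY
        refine ⟨?_, fun h => hi i (hpre h)⟩
        rw [length_initSeg]
        exact (Finset.le_sup (f := fun i => (approx T C t (ρ ++ [i])).length)
          (Finset.mem_range.2 hiY)).trans ((le_max_right _ _).trans hk)

theorem isPi01In_imageSet {A : ℕ → ℕ} {T : Str → Bool} {C : ℕ → Str → Bool}
    (hT : UnifComp (fun _ : Unit => A) fun _ => T)
    (hC : UnifComp (fun _ : Unit => A) fun _ (q : ℕ × Str) => C q.1 q.2) :
    IsPi01In A (imageSet T C) := by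
  rw [imageSet_eq_forall]
  exact isPi01In_of_forall (hT.bad hC).not

/-! ### Jump inversion for `Π⁰₁` classes -/

/-- Machine `e` with oracle `τ ⊕ A` is seen to halt on input `e`. -/
noncomputable def haltsJoin (A : ℕ → ℕ) (e : ℕ) (τ : Str) : Bool :=
  haltsB e (initSeg (oplus (fun i => τ.getD i 0) A) (2 * τ.length))

theorem haltsJoin_initSeg (A Y : ℕ → ℕ) (e m : ℕ) :
    haltsJoin A e (initSeg Y m) = haltsB e (initSeg (oplus Y A) (2 * m)) := by
  rw [haltsJoin, length_initSeg]
  congr 1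
  refine initSeg_congr_iff.2 fun i hi => ?_
  simp only [oplus]
  rw [List.getD_eq_getElem?_getD, getElem?_initSeg (by omega)]
  rfl

theorem haltsJoin_mono {A : ℕ → ℕ} {e : ℕ} {σ τ : Str} (h : σ <+: τ)
    (hσ : haltsJoin A e σ = true) : haltsJoin A e τ = true := by
  have hτ : initSeg (fun i => τ.getD i 0) τ.length = τ :=
    initOf_iff.2 fun k hk => by simp [hk]
  rw [← hτ, haltsJoin_initSeg]
  have h1 : InitOf σ fun i => τ.getD i 0 := InitOf.of_prefix hτ h
  rw [← h1, haltsJoin_initSeg] at hσ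
  exact haltsB_mono (initSeg_prefix _ (Nat.mul_le_mul_left 2 h.length_le)) hσ

theorem jump_oplus_eq_one_iff {A Y : ℕ → ℕ} {e : ℕ} :
    jump (oplus Y A) e = 1 ↔ ∃ m, haltsJoin A e (initSeg Y m) = true := by
  simp only [jump_eq_one_iff, haltsJoin_initSeg]
  exact ⟨fun ⟨m, hm⟩ => ⟨m, haltsB_mono (initSeg_prefix _ (by omega)) hm⟩, fun ⟨m, hm⟩ => ⟨_, hm⟩⟩

namespace UnifComp

variable {ι : Type*} {O : ι → ℕ → ℕ}

theorem haltsJoin {A : ℕ → ℕ} (hA : UnifComp O fun _ => A) :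
    UnifComp O fun _ (q : ℕ × Str) => haltsJoin A q.1 q.2 := by
  have half : UnifComp O fun _ (q : (ℕ × Str) × ℕ) => q.2 / 2 :=
    comp₂ Primrec.nat_div id.snd (const 2)
  have hf := ite (rel Primrec.eq (comp₂ Primrec.nat_mod (id (O := O) (α := (ℕ × Str) × ℕ)).snd
    (const 2)) (const 0)) (comp₂ (Primrec.list_getD 0) id.fst.snd half) (hA.comp half)
  have h := comp₂ primrec_haltsB id.fst (map_range hf (comp₂ Primrec.nat_mul (const 2)
    (comp₁ Primrec.list_length (id (O := O) (α := ℕ × Str)).snd)))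
  convert h using 4 with i q
  simp only [Harrington.haltsJoin, Harrington.initSeg, cond_eq_ite, decide_eq_true_eq]
  rfl

theorem pathMap {f : Str → Str} {X : ι → ℕ → ℕ} (hf : UnifComp O fun _ => f)
    (hX : UnifComp O X) : UnifComp O fun i => pathMap f (X i) :=
  comp₂ (h := fun l n => l.getD n 0) (Primrec.list_getD 0)
    (hf.comp (initSeg hX (of_primrec Primrec.succ))) id

theorem of_pathMap {f : Str → Str} {X : ι → ℕ → ℕ} (hs : IsShiftMap f) (hf : UnifComp O fun _ => f)
    (hX : UnifComp O fun i => Harrington.pathMap f (X i)) : UnifComp O X := by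
  let dec : ℕ → Str := fun m => (decode m).getD []
  have hdec : Primrec dec := Primrec.option_getD.comp .decode (.const _)
  have d : UnifComp O fun _ (q : ℕ × ℕ) => dec q.2 := comp₁ hdec id.snd
  have h := find ((rel Primrec.eq (comp₁ Primrec.list_length d) (comp₁ Primrec.succ id.fst)).and
    (rel Primrec.eq (initSeg hX (comp₁ Primrec.list_length (hf.comp d))) (hf.comp d)))
    fun i n => ⟨encode (Harrington.initSeg (X i) (n + 1)), by
      have := hs.initOf_pathMap (X i) (n + 1)
      rw [InitOf] at this
      simp [dec, this]⟩
  have h2 := comp₂ (Primrec.list_getD 0) (comp₁ hdec h) id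
  convert h2 using 3 with i n
  generalize_proofs hex
  have h3 := Nat.find_spec hex
  generalize Nat.find hex = m at h3 ⊢
  simp only [Bool.and_eq_true, decide_eq_true_eq] at h3
  have h4 := initOf_iff.1 (hs.initOf_of_initOf_pathMap h3.2) n (by rw [h3.1]; exact n.lt_succ_self)
  rw [List.getD_eq_getElem?_getD, h4]
  rfl

/-- `(Y ⊕ A)'` computes `Y ⊕ A'`. -/
theorem oplus_jump (Y : ι → ℕ → ℕ) (A : ℕ → ℕ) :
    UnifComp (fun i => jump (Harrington.oplus (Y i) A)) fun i => Harrington.oplus (Y i) (jump A) :=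
  oplus oplus_left.of_jump (jump_of_oracle oplus_right)

end UnifComp

/-- Jump inversion for a `Π⁰₁` class given by an `A`-decidable set of strings. -/
theorem exists_jump_inversion {A : ℕ → ℕ} {T : Str → Bool}
    (hT : UnifComp (fun _ : Unit => A) fun _ => T) :
    ∃ F : (ℕ → ℕ) → ℕ → ℕ, IsPi01In A (F '' {X | ∀ n, T (initSeg X n) = true}) ∧
      UnifComp (fun X => oplus X (jump A)) F ∧
      UnifComp (fun X => oplus (F X) (jump A)) (fun X => X) ∧
      UnifComp (fun X : {X | ∀ n, T (initSeg X n) = true} => oplus (F X) (jump A))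
        (fun X => jump (oplus (F X) A)) := by
  have hC := UnifComp.haltsJoin (UnifComp.oracle (O := fun _ : Unit => A))
  have hs := isShiftMap_limit (T := T) (C := haltsJoin A)
  have hl := UnifComp.limit hT hC
  have hinv : UnifComp (fun X => oplus (pathMap (limit T (haltsJoin A)) X) (jump A)) fun X => X :=
    UnifComp.of_pathMap hs (hl.const_oracle UnifComp.oplus_right) UnifComp.oplus_left
  refine ⟨pathMap (limit T (haltsJoin A)), ?_, ?_, hinv, ?_⟩
  · rw [← imageSet_eq]
    exact isPi01In_imageSet hT hC
  · exact UnifComp.pathMap (hl.const_oracle UnifComp.oplus_right) UnifComp.oplus_left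
  · have hX := hinv.reindex fun X : {X | ∀ n, T (initSeg X n) = true} => X.1
    have h := ((hC.of_jump.const_oracle UnifComp.oplus_right).comp (UnifComp.id.pair
      ((hl.const_oracle UnifComp.oplus_right).comp (hX.initSeg UnifComp.id)))).ite
      (UnifComp.const (1 : ℕ)) (UnifComp.const 0)
    convert h using 3 with X e
    rw [cond_eq_ite]
    have := exists_iff_limit (T := T) (C := haltsJoin A) (fun e σ τ => haltsJoin_mono) X.2 e
    rw [← jump_oplus_eq_one_iff] at this
    simp only [← this]
    rcases jump_eq_zero_or_one (oplus (pathMap (limit T (haltsJoin A)) X) A) e with h | h <;>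
      simp [h]

/-! ### From `Π⁰₁` in the jump to `Π⁰₁` -/

/-- The approximation to the initial segment of `A'` of length `j` after `u` steps. -/
noncomputable def jumpApprox (A : ℕ → ℕ) (u j : ℕ) : Str :=
  (List.range j).map fun i => bif haltsB i (initSeg A u) then 1 else 0

theorem jumpApprox_eventually (A : ℕ → ℕ) (j : ℕ) :
    ∀ᶠ u in atTop, jumpApprox A u j = initSeg (jump A) j := by
  have h : ∀ i ∈ Finset.range j, ∀ᶠ u in atTop,
      (bif haltsB i (initSeg A u) then 1 else 0) = jump A i := by
    intro i _
    by_cases h1 : jump A i = 1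
    · obtain ⟨m, hm⟩ := jump_eq_one_iff.1 h1
      filter_upwards [eventually_ge_atTop m] with u hu
      rw [h1, haltsB_mono (initSeg_prefix A hu) hm]
      rfl
    · refine Eventually.of_forall fun u => ?_
      rw [jump_eq_zero_iff.2 h1, cond_eq_ite, if_neg]
      exact fun hu => h1 (jump_eq_one_iff.2 ⟨u, hu⟩)
  filter_upwards [(Filter.eventually_all_finset _).2 h] with u hu
  simpa [jumpApprox, initSeg] using hu

theorem UnifComp.jumpApprox {ι α : Type*} [Primcodable α] {O : ι → ℕ → ℕ} {A : ℕ → ℕ}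
    {u j : ι → α → ℕ} (hA : UnifComp O fun _ => A) (hu : UnifComp O u) (hj : UnifComp O j) :
    UnifComp O fun i a => jumpApprox A (u i a) (j i a) :=
  map_range (f := fun i q => bif Harrington.haltsB q.2 (Harrington.initSeg A (u i q.1)) then 1
    else 0) ((UnifComp.haltsB hA id.snd (hu.comp id.fst)).ite (const 1) (const 0)) hj

/-- A set decidable in `A'` is the set of solutions of a `∀∃`-formula over `A`. -/
theorem exists_forall_exists {A : ℕ → ℕ} {T : Set Str} (hT : SetRecIn (jump A) T) :
    ∃ R : (Str × ℕ) × ℕ → Bool, UnifComp (fun _ : Unit => A) (fun _ => R) ∧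
      ∀ σ, σ ∈ T ↔ ∀ k, ∃ b, R ((σ, k), b) = true := by
  obtain ⟨c, hc⟩ := hT
  let E : (Str × ℕ) × ℕ → Option ℕ := fun q => Code.evaln q.1.2.unpair.2
    (c.toCode (jumpApprox A q.1.2.unpair.2 q.1.2.unpair.1)) (encode q.1.1)
  let O : Unit → ℕ → ℕ := fun _ => A
  have hA : UnifComp O fun _ => A := UnifComp.oracle
  have j : UnifComp O fun _ (q : (Str × ℕ) × ℕ) => q.1.2.unpair.1 :=
    (UnifComp.comp₁ Primrec.unpair UnifComp.id.fst.snd).fst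
  have u : UnifComp O fun _ (q : (Str × ℕ) × ℕ) => q.1.2.unpair.2 :=
    (UnifComp.comp₁ Primrec.unpair UnifComp.id.fst.snd).snd
  have J := UnifComp.jumpApprox hA u j
  have J' := UnifComp.jumpApprox hA (UnifComp.comp₂ Primrec.nat_add u UnifComp.id.snd) j
  have hcode : Primrec fun τ => c.toCode τ :=
    (primrec_toCode_ofNat.comp Primrec.id (Primrec.const c.toNat)).of_eq fun τ => by
      rw [OCode.ofNat_toNat, id]
  have hE : UnifComp O fun _ => E := UnifComp.comp₁ Code.primrec_evaln
    ((u.pair (UnifComp.comp₁ hcode J)).pair (UnifComp.comp₁ Primrec.encode UnifComp.id.fst.fst))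
  refine ⟨fun q => !decide (E q = some 0) ||
    !decide (jumpApprox A (q.1.2.unpair.2 + q.2) q.1.2.unpair.1 =
      jumpApprox A q.1.2.unpair.2 q.1.2.unpair.1),
    (UnifComp.rel Primrec.eq hE (UnifComp.const (some 0))).not.or
      (UnifComp.rel Primrec.eq J' J).not, fun σ => ?_⟩
  simp only [Bool.or_eq_true, Bool.not_eq_true', decide_eq_false_iff_not]
  constructor
  · intro hσ k
    obtain ⟨b, hb⟩ := eventually_atTop.1 (jumpApprox_eventually A k.unpair.1)
    refine ⟨b, ?_⟩
    rw [or_iff_not_imp_left, not_not]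
    intro h0 h1
    rw [hb _ (Nat.le_add_left _ _)] at h1
    have h2 : 0 ∈ evalo (jump A) c (encode σ) := by
      refine evalo_of_toCode_initSeg (j := k.unpair.1) ?_
      rw [h1]
      exact Code.evaln_sound h0
    rw [hc σ] at h2
    simpa [chi, hσ] using Part.mem_some_iff.1 h2
  · intro h
    by_contra hσ
    have h0 : 0 ∈ evalo (jump A) c (encode σ) := by
      rw [hc σ]
      simp [chi, hσ]
    obtain ⟨j, hj⟩ := (toCode_eventually _ _ _ _ h0).exists
    obtain ⟨s, hs⟩ := Code.evaln_complete.1 hj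
    obtain ⟨b, hb⟩ := eventually_atTop.1 (jumpApprox_eventually A j)
    obtain ⟨b', hb'⟩ := h (Nat.pair j (max s b))
    simp only [E, Nat.unpair_pair] at hb'
    rw [hb _ (le_max_right _ _), hb _ (by omega)] at hb'
    rcases hb' with h1 | h1
    · exact h1 (Code.evaln_mono (le_max_left _ _) hs)
    · exact h1 rfl

/-- Join `X` with the least witnesses for the validity of its initial segments. -/
noncomputable def withWitness (R : (Str × ℕ) × ℕ → Bool) (X : ℕ → ℕ) (N : ℕ) : ℕ :=
  Nat.pair (X N) (sInf {b | R ((initSeg X N.unpair.1, N.unpair.2), b) = true})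

/-- `b` is the least witness for `q`. -/
def LeastWitness (R : (Str × ℕ) × ℕ → Bool) (q : Str × ℕ) (b : ℕ) : Prop :=
  R (q, b) = true ∧ ∀ b' < b, (!R (q, b')) = true

theorem leastWitness_sInf {R : (Str × ℕ) × ℕ → Bool} {q : Str × ℕ} (h : ∃ b, R (q, b) = true) :
    LeastWitness R q (sInf {b | R (q, b) = true}) :=
  ⟨Nat.sInf_mem (s := {b | R (q, b) = true}) h, fun b' hb' => by
    simpa using Nat.notMem_of_lt_sInf hb'⟩

theorem LeastWitness.eq_sInf {R : (Str × ℕ) × ℕ → Bool} {q : Str × ℕ} {b : ℕ}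
    (h : LeastWitness R q b) : b = sInf {b | R (q, b) = true} := by
  refine le_antisymm ?_ (Nat.sInf_le h.1)
  by_contra! hlt
  have := h.2 _ hlt
  rw [(leastWitness_sInf ⟨b, h.1⟩).1] at this
  simp at this

theorem exists_image_withWitness {A : ℕ → ℕ} {R : (Str × ℕ) × ℕ → Bool}
    (hR : UnifComp (fun _ : Unit => A) fun _ => R) :
    ∃ V : Str → Bool, UnifComp (fun _ : Unit => A) (fun _ => V) ∧
      {Z | ∀ n, V (initSeg Z n) = true} =
        withWitness R '' {X | ∀ n k, ∃ b, R ((initSeg X n, k), b) = true} := by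
  let O : Unit → ℕ → ℕ := fun _ => A
  have N : UnifComp O fun _ (a : Str × ℕ) => a.2.unpair :=
    UnifComp.comp₁ Primrec.unpair UnifComp.id.snd
  have z : UnifComp O fun _ (a : Str × ℕ) => (a.1.getD a.2 0).unpair.2 :=
    (UnifComp.comp₁ Primrec.unpair
      (UnifComp.comp₂ (Primrec.list_getD 0) UnifComp.id.fst UnifComp.id.snd)).snd
  have x : UnifComp O fun _ (a : Str × ℕ) => (a.1.map fun v => v.unpair.1).take a.2.unpair.1 :=
    UnifComp.comp₂ Primrec.list_take N.fst (UnifComp.of_primrec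
      (Primrec.list_map Primrec.fst (Primrec.fst.comp (Primrec.unpair.comp .snd))))
  have q := x.pair N.snd
  have hV := UnifComp.forall_lt ((hR.comp (q.pair z)).and (UnifComp.forall_lt
    (hR.comp ((q.comp UnifComp.id.fst).pair UnifComp.id.snd)).not z))
    (UnifComp.of_primrec Primrec.list_length)
  refine ⟨_, hV, ?_⟩
  have key : ∀ Z : ℕ → ℕ, (∀ n, ∀ k < n, LeastWitness R
      (((initSeg Z n).map fun v => v.unpair.1).take k.unpair.1, k.unpair.2)
        ((initSeg Z n).getD k 0).unpair.2) ↔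
      ∀ k, LeastWitness R (initSeg (fun i => (Z i).unpair.1) k.unpair.1, k.unpair.2)
        (Z k).unpair.2 := by
    intro Z
    have h : ∀ {n k : ℕ}, k < n →
        ((initSeg Z n).map fun v => v.unpair.1).take k.unpair.1 =
          initSeg (fun i => (Z i).unpair.1) k.unpair.1 ∧ (initSeg Z n).getD k 0 = Z k := by
      intro n k hk
      have h1 : (initSeg Z n).map (fun v => v.unpair.1) = initSeg (fun i => (Z i).unpair.1) n := by
        simp [initSeg]
      rw [h1, take_initSeg, min_eq_left ((Nat.unpair_left_le k).trans hk.le),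
        List.getD_eq_getElem?_getD, getElem?_initSeg hk]
      exact ⟨rfl, rfl⟩
    constructor
    · intro hZ k
      have := hZ (k + 1) k k.lt_succ_self
      rwa [(h k.lt_succ_self).1, (h k.lt_succ_self).2] at this
    · intro hZ n k hk
      rw [(h hk).1, (h hk).2]
      exact hZ k
  ext Z
  simp only [Set.mem_ofPred_eq, decide_eq_true_eq, length_initSeg, Bool.and_eq_true, Set.mem_image]
  refine (key Z).trans ⟨fun h => ?_, ?_⟩
  · refine ⟨fun i => (Z i).unpair.1, fun n k => ?_, ?_⟩
    · have := h (Nat.pair n k)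
      rw [Nat.unpair_pair] at this
      exact ⟨_, this.1⟩
    · funext k
      rw [withWitness, ← (h k).eq_sInf, Nat.pair_unpair]
  · rintro ⟨X, hX, rfl⟩ k
    simpa [withWitness] using leastWitness_sInf (hX k.unpair.1 k.unpair.2)

theorem UnifComp.withWitness {ι : Type*} {O : ι → ℕ → ℕ} {R : (Str × ℕ) × ℕ → Bool}
    {X : ι → ℕ → ℕ} (hR : UnifComp O fun _ => R) (hX : UnifComp O X)
    (h : ∀ i n k, ∃ b, R ((Harrington.initSeg (X i) n, k), b) = true) :
    UnifComp O fun i => withWitness R (X i) := by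
  have N : UnifComp O fun _ (q : ℕ × ℕ) => q.1.unpair := comp₁ Primrec.unpair id.fst
  have hf := find (hR.comp (((initSeg hX N.fst).pair N.snd).pair id.snd)) fun i n =>
    h i n.unpair.1 n.unpair.2
  have h2 := comp₂ Primrec₂.natPair hX hf
  convert h2 using 3 with i n
  refine congrArg _ (LeastWitness.eq_sInf ⟨Nat.find_spec (h i _ _), fun b hb => ?_⟩).symm
  simpa using Nat.find_min _ hb

theorem UnifComp.of_withWitness {ι : Type*} {O : ι → ℕ → ℕ} {R : (Str × ℕ) × ℕ → Bool}
    {X : ι → ℕ → ℕ} (h : UnifComp O fun i => Harrington.withWitness R (X i)) : UnifComp O X := by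
  have := (comp₁ Primrec.unpair h).fst
  simpa [Harrington.withWitness] using this

theorem homeoOn_image {B : ℕ → ℕ} {H : (ℕ → ℕ) → ℕ → ℕ} {P : Set (ℕ → ℕ)} {c d : OCode}
    (hc : ∀ X ∈ P, computesFn (oplus X B) c (H X)) (hd : ∀ X ∈ P, computesFn (oplus (H X) B) d X) :
    HomeoOn H P (H '' P) := by
  have hinj : Set.InjOn H P := by
    intro X hX Y hY h
    funext n
    have h1 := hd X hX n
    rw [h, hd Y hY n] at h1
    exact (Part.some_injective h1).symm
  refine ⟨hinj.bijOn_image, continuousOn_of_computesFn hc, Function.invFunOn H P,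
    hinj.bijOn_image.invOn_invFunOn, continuousOn_of_computesFn (c := d) (B := B) ?_⟩
  rintro _ ⟨X, hX, rfl⟩
  rw [hinj.leftInvOn_invFunOn hX]
  exact hd X hX

end

/-- **Lemma.**  Given a `Π^{0,A'}_1` set `P` there are a `Π^{0,A}_1` set `Q` and a
homeomorphism `H : P → Q` such that `X ⊕ A' ≡_T H(X) ⊕ A' ≡_T (H(X) ⊕ A)'` uniformly
for all `X ∈ P`. -/
theorem pi01_jump_inversion (A : ℕ → ℕ) (P : Set (ℕ → ℕ))
    (hP : IsPi01In (jump A) P) :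
    ∃ (Q : Set (ℕ → ℕ)) (H : (ℕ → ℕ) → (ℕ → ℕ)), IsPi01In A Q ∧ HomeoOn H P Q ∧
      UnifEquivOn P (fun X => oplus X (jump A)) (fun X => oplus (H X) (jump A)) ∧
      UnifEquivOn P (fun X => oplus (H X) (jump A)) (fun X => jump (oplus (H X) A)) := by
  obtain ⟨T, -, hT, rfl⟩ := hP
  obtain ⟨R, hR, hTR⟩ := exists_forall_exists hT
  obtain ⟨V, hV, hVR⟩ := exists_image_withWitness hR
  have hP : paths T = {X | ∀ n k, ∃ b, R ((initSeg X n, k), b) = true} := by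
    ext X
    simp only [paths, Set.mem_ofPred_eq, hTR]
  obtain ⟨F, hQ, hF, hFinv, hFjump⟩ := exists_jump_inversion hV
  have hW : UnifComp (fun X : paths T => oplus X (jump A)) fun X => withWitness R X :=
    (hR.of_jump.const_oracle UnifComp.oplus_right).withWitness UnifComp.oplus_left fun X =>
      hP.subset X.2
  have hH : UnifComp (fun X : paths T => oplus X (jump A)) fun X => F (withWitness R X) :=
    (hF.reindex fun X : paths T => withWitness R X).of_oracle (hW.oplus UnifComp.oplus_right)
  have hHinv : UnifComp (fun X : paths T => oplus (F (withWitness R X)) (jump A)) fun X => X.1 :=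
    UnifComp.of_withWitness (hFinv.reindex fun X : paths T => withWitness R X)
  have hjump : UnifComp (fun X : paths T => oplus (F (withWitness R X)) (jump A))
      fun X => jump (oplus (F (withWitness R X)) A) :=
    hFjump.reindex fun X : paths T =>
      ⟨withWitness R X, by rw [hVR, ← hP]; exact Set.mem_image_of_mem _ X.2⟩
  refine ⟨(fun X => F (withWitness R X)) '' paths T, fun X => F (withWitness R X), ?_, ?_, ?_, ?_⟩
  · rwa [hVR, ← hP, Set.image_image] at hQ
  · obtain ⟨c, hc⟩ := hH
    obtain ⟨d, hd⟩ := hHinv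
    exact homeoOn_image (fun X hX => hc ⟨X, hX⟩) fun X hX => hd ⟨X, hX⟩
  · obtain ⟨c, hc⟩ := hHinv.oplus UnifComp.oplus_right
    obtain ⟨d, hd⟩ := hH.oplus UnifComp.oplus_right
    exact ⟨c, d, fun X hX => ⟨hc ⟨X, hX⟩, hd ⟨X, hX⟩⟩⟩
  · obtain ⟨c, hc⟩ := UnifComp.oplus_jump (fun X : paths T => F (withWitness R X)) A
    obtain ⟨d, hd⟩ := hjump
    exact ⟨c, d, fun X hX => ⟨hc ⟨X, hX⟩, hd ⟨X, hX⟩⟩⟩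

end Harrington
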